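/- arXiv:1311.5994 — 20 statements merged into one kernel-verified Lean document; each statement's English description precedes it below -/
import Mathlib

section
/- Let a, b, c be positive real numbers with a² + b² + c² = 1 and max(a², b², c²) ≤ 1/2 (so a, b, c are the sides of a triangle with no obtuse angle). Let ψ be the three-qubit state with ψ 1 0 0 = a, ψ 0 1 0 = b, ψ 0 0 1 = c and all other components 0. Then Λmax(ψ)² = 4·(a·b·c)² / ((a+b+c)·(−a+b+c)·(a−b+c)·(a+b−c)); that is, Λmax(ψ) equals twice the circumradius of the triangle with side lengths a, b, c. -/
open scoped BigOperators

/-- The product overlap of a three-qubit state `ψ` with single-qubit vectors `u, v, w`. -/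
noncomputable def prodOverlap (ψ : Fin 2 → Fin 2 → Fin 2 → ℂ) (u v w : Fin 2 → ℂ) : ℝ :=
  ‖∑ i : Fin 2, ∑ j : Fin 2, ∑ k : Fin 2,
      (starRingEnd ℂ) (u i) * (starRingEnd ℂ) (v j) * (starRingEnd ℂ) (w k) * ψ i j k‖

/-- The maximal product overlap `Λmax` of a three-qubit state: the supremum of the
product overlap over all triples of unit vectors. -/
noncomputable def Lmax (ψ : Fin 2 → Fin 2 → Fin 2 → ℂ) : ℝ :=
  sSup {r : ℝ | ∃ u v w : Fin 2 → ℂ,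
    (∑ i : Fin 2, ‖u i‖ ^ 2) = 1 ∧ (∑ i : Fin 2, ‖v i‖ ^ 2) = 1 ∧
      (∑ i : Fin 2, ‖w i‖ ^ 2) = 1 ∧ r = prodOverlap ψ u v w}

/-- Product overlap of a W-type state, written out in coordinates. -/
lemma prodOverlap_W_type {a b c : ℝ} {ψ : Fin 2 → Fin 2 → Fin 2 → ℂ}
    (h100 : ψ 1 0 0 = (a : ℂ)) (h010 : ψ 0 1 0 = (b : ℂ)) (h001 : ψ 0 0 1 = (c : ℂ))
    (hzero : ∀ i j k : Fin 2, ¬(i = 1 ∧ j = 0 ∧ k = 0) → ¬(i = 0 ∧ j = 1 ∧ k = 0) →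
      ¬(i = 0 ∧ j = 0 ∧ k = 1) → ψ i j k = 0) (u v w : Fin 2 → ℂ) :
    prodOverlap ψ u v w =
      ‖(a : ℂ) * (u 1 * v 0 * w 0) + b * (u 0 * v 1 * w 0) + c * (u 0 * v 0 * w 1)‖ := by
  have h000 : ψ 0 0 0 = 0 := hzero 0 0 0 (by decide) (by decide) (by decide)
  have h011 : ψ 0 1 1 = 0 := hzero 0 1 1 (by decide) (by decide) (by decide)
  have h101 : ψ 1 0 1 = 0 := hzero 1 0 1 (by decide) (by decide) (by decide)
  have h110 : ψ 1 1 0 = 0 := hzero 1 1 0 (by decide) (by decide) (by decide)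
  have h111 : ψ 1 1 1 = 0 := hzero 1 1 1 (by decide) (by decide) (by decide)
  rw [prodOverlap, ← Complex.norm_conj]
  congr 1
  simp only [Fin.sum_univ_two, h100, h010, h001, h000, h011, h101, h110, h111, map_add, map_mul,
    Complex.conj_conj, Complex.conj_ofReal, mul_zero, zero_add, add_zero]
  ring

/-- The product overlap of a W-type state with triangle sides `a, b, c` is at most twice the
circumradius, in a homogeneous form free of divisions. -/
lemma heron_mul_sq_le (a b c x₁ y₁ x₂ y₂ x₃ y₃ : ℝ)
    (hD : 0 ≤ (a + b + c) * (-a + b + c) * (a - b + c) * (a + b - c)) :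
    (a + b + c) * (-a + b + c) * (a - b + c) * (a + b - c) *
        (a * (y₁ * x₂ * x₃) + b * (x₁ * y₂ * x₃) + c * (x₁ * x₂ * y₃)) ^ 2 ≤
      4 * (a * b * c) ^ 2 * ((x₁ ^ 2 + y₁ ^ 2) * (x₂ ^ 2 + y₂ ^ 2) * (x₃ ^ 2 + y₃ ^ 2)) := by
  set D := (a + b + c) * (-a + b + c) * (a - b + c) * (a + b - c) with hDdef
  have cauchy : (a * (y₁ * x₂ * x₃) + b * (x₁ * y₂ * x₃) + c * (x₁ * x₂ * y₃)) ^ 2 ≤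
      (x₁ ^ 2 + y₁ ^ 2) * ((a * x₂ * x₃) ^ 2 + (b * y₂ * x₃ + c * x₂ * y₃) ^ 2) := by
    linear_combination sq_nonneg (x₁ * (a * x₂ * x₃) - y₁ * (b * y₂ * x₃ + c * x₂ * y₃))
  have sos : D * ((a * x₂ * x₃) ^ 2 + (b * y₂ * x₃ + c * x₂ * y₃) ^ 2) ≤
      4 * (a * b * c) ^ 2 * ((x₂ ^ 2 + y₂ ^ 2) * (x₃ ^ 2 + y₃ ^ 2)) := by
    rw [hDdef]
    linear_combination
      sq_nonneg (a * (2 * b * c * (y₂ * y₃) - (b ^ 2 + c ^ 2 - a ^ 2) * (x₂ * x₃))) +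
      sq_nonneg (b * (a ^ 2 + c ^ 2 - b ^ 2) * (y₂ * x₃) -
        c * (a ^ 2 + b ^ 2 - c ^ 2) * (x₂ * y₃))
  linear_combination D * cauchy + (x₁ ^ 2 + y₁ ^ 2) * sos

theorem Lmax_W_type_highly_entangled (a b c : ℝ) (ha : 0 < a) (hb : 0 < b) (hc : 0 < c)
    (hnorm : a ^ 2 + b ^ 2 + c ^ 2 = 1)
    (hmax : max (a ^ 2) (max (b ^ 2) (c ^ 2)) ≤ 1 / 2)
    (ψ : Fin 2 → Fin 2 → Fin 2 → ℂ)
    (h100 : ψ 1 0 0 = (a : ℂ)) (h010 : ψ 0 1 0 = (b : ℂ)) (h001 : ψ 0 0 1 = (c : ℂ))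
    (hzero : ∀ i j k : Fin 2, ¬(i = 1 ∧ j = 0 ∧ k = 0) → ¬(i = 0 ∧ j = 1 ∧ k = 0) →
      ¬(i = 0 ∧ j = 0 ∧ k = 1) → ψ i j k = 0) :
    (Lmax ψ) ^ 2 =
      4 * (a * b * c) ^ 2 / ((a + b + c) * (-a + b + c) * (a - b + c) * (a + b - c)) := by
  simp only [max_le_iff] at hmax
  obtain ⟨ha2, hb2, hc2⟩ := hmax
  set D := (a + b + c) * (-a + b + c) * (a - b + c) * (a + b - c) with hDdef
  set p := √(b ^ 2 + c ^ 2 - a ^ 2)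
  set q := √(a ^ 2 + c ^ 2 - b ^ 2)
  set s := √(a ^ 2 + b ^ 2 - c ^ 2)
  have hp2 : p ^ 2 = b ^ 2 + c ^ 2 - a ^ 2 := Real.sq_sqrt (by linarith)
  have hq2 : q ^ 2 = a ^ 2 + c ^ 2 - b ^ 2 := Real.sq_sqrt (by linarith)
  have hs2 : s ^ 2 = a ^ 2 + b ^ 2 - c ^ 2 := Real.sq_sqrt (by linarith)
  have hDa : D = 2 * a ^ 2 * p ^ 2 + q ^ 2 * s ^ 2 := by rw [hDdef, hp2, hq2, hs2]; ring
  have hDb : D = 2 * b ^ 2 * q ^ 2 + p ^ 2 * s ^ 2 := by rw [hDdef, hp2, hq2, hs2]; ring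
  have hDc : D = 2 * c ^ 2 * s ^ 2 + p ^ 2 * q ^ 2 := by rw [hDdef, hp2, hq2, hs2]; ring
  have hDs : D = q ^ 2 * s ^ 2 + p ^ 2 * s ^ 2 + p ^ 2 * q ^ 2 := by
    rw [hDdef, hp2, hq2, hs2]; ring
  have hDpos : 0 < D := by
    rcases (sq_nonneg p).eq_or_lt with h | h
    · have h1 : q ^ 2 = 2 * c ^ 2 := by linarith
      have h2 : s ^ 2 = 2 * b ^ 2 := by linarith
      rw [hDa, ← h, h1, h2]
      positivity
    · rw [hDa]
      positivity
  set m := √D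
  have hm0 : 0 < m := Real.sqrt_pos.2 hDpos
  have hm2 : m ^ 2 = D := Real.sq_sqrt hDpos.le
  have h2 : √(2 : ℝ) ^ 2 = 2 := Real.sq_sqrt zero_le_two
  have greatest : IsGreatest {r : ℝ | ∃ u v w : Fin 2 → ℂ,
      (∑ i : Fin 2, ‖u i‖ ^ 2) = 1 ∧ (∑ i : Fin 2, ‖v i‖ ^ 2) = 1 ∧
        (∑ i : Fin 2, ‖w i‖ ^ 2) = 1 ∧ r = prodOverlap ψ u v w} (2 * (a * b * c) / m) := by
    constructor
    · refine ⟨![((√2 * a * p / m : ℝ) : ℂ), ((q * s / m : ℝ) : ℂ)],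
        ![((√2 * b * q / m : ℝ) : ℂ), ((p * s / m : ℝ) : ℂ)],
        ![((√2 * c * s / m : ℝ) : ℂ), ((p * q / m : ℝ) : ℂ)], ?_, ?_, ?_, ?_⟩
      · simp only [Fin.sum_univ_two, Matrix.cons_val_zero, Matrix.cons_val_one, Complex.norm_real,
          Real.norm_eq_abs, sq_abs, div_pow, mul_pow, h2, hm2]
        rw [← add_div, ← hDa, div_self hDpos.ne']
      · simp only [Fin.sum_univ_two, Matrix.cons_val_zero, Matrix.cons_val_one, Complex.norm_real,
          Real.norm_eq_abs, sq_abs, div_pow, mul_pow, h2, hm2]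
        rw [← add_div, ← hDb, div_self hDpos.ne']
      · simp only [Fin.sum_univ_two, Matrix.cons_val_zero, Matrix.cons_val_one, Complex.norm_real,
          Real.norm_eq_abs, sq_abs, div_pow, mul_pow, h2, hm2]
        rw [← add_div, ← hDc, div_self hDpos.ne']
      · rw [prodOverlap_W_type h100 h010 h001 hzero]
        simp only [Matrix.cons_val_zero, Matrix.cons_val_one, ← Complex.ofReal_mul,
          ← Complex.ofReal_add, Complex.norm_real, Real.norm_eq_abs]
        rw [abs_of_nonneg (by positivity)]
        field_simp
        rw [h2, hm2, hDs]
        ring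
    · rintro r ⟨u, v, w, hu, hv, hw, rfl⟩
      rw [prodOverlap_W_type h100 h010 h001 hzero]
      rw [Fin.sum_univ_two] at hu hv hw
      have bound := heron_mul_sq_le a b c ‖u 0‖ ‖u 1‖ ‖v 0‖ ‖v 1‖ ‖w 0‖ ‖w 1‖ hDpos.le
      rw [hu, hv, hw, ← hDdef, ← hm2] at bound
      calc _ ≤ a * (‖u 1‖ * ‖v 0‖ * ‖w 0‖) + b * (‖u 0‖ * ‖v 1‖ * ‖w 0‖) +
            c * (‖u 0‖ * ‖v 0‖ * ‖w 1‖) := by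
            refine (norm_add₃_le).trans_eq ?_
            simp only [norm_mul, Complex.norm_real, Real.norm_eq_abs, abs_of_pos ha, abs_of_pos hb,
              abs_of_pos hc]
        _ ≤ _ := by
            rw [le_div_iff₀ hm0]
            refine le_of_sq_le_sq ?_ (by positivity)
            linear_combination bound
  rw [Lmax, greatest.csSup_eq, div_pow, hm2]
  ring
end

section
/- Let a, b, c be positive real numbers with a² + b² + c² = 1 and max(a², b², c²) ≥ 1/2. Let ψ be the three-qubit state with ψ 1 0 0 = a, ψ 0 1 0 = b, ψ 0 0 1 = c and all other components 0. Then Λmax(ψ)² = max(a², b², c²). -/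
/-- The key real inequality: a trilinear W-type form is bounded on unit vectors by its dominant
coefficient `a` as soon as `b ^ 2 + c ^ 2 ≤ a ^ 2`. -/
theorem wForm_sq_le {a b c : ℝ} (h : b ^ 2 + c ^ 2 ≤ a ^ 2) {x₀ x₁ y₀ y₁ z₀ z₁ : ℝ}
    (hx : x₀ ^ 2 + x₁ ^ 2 = 1) (hy : y₀ ^ 2 + y₁ ^ 2 = 1) (hz : z₀ ^ 2 + z₁ ^ 2 = 1) :
    (a * (x₁ * y₀ * z₀) + b * (x₀ * y₁ * z₀) + c * (x₀ * y₀ * z₁)) ^ 2 ≤ a ^ 2 := by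
  set p := a * x₁ * y₀ + b * x₀ * y₁
  set q := c * x₀ * y₀
  have cauchy : (p * z₀ + q * z₁) ^ 2 ≤ p ^ 2 + q ^ 2 := by
    have : p ^ 2 + q ^ 2 = (p ^ 2 + q ^ 2) * (z₀ ^ 2 + z₁ ^ 2) := by rw [hz, mul_one]
    nlinarith [sq_nonneg (p * z₁ - q * z₀)]
  have hq : q ^ 2 ≤ (a ^ 2 - b ^ 2) * (x₀ * y₀) ^ 2 := by
    have : q ^ 2 = c ^ 2 * (x₀ * y₀) ^ 2 := by ring
    rw [this]
    gcongr
    linarith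
  have hp : p ^ 2 + (a ^ 2 - b ^ 2) * (x₀ * y₀) ^ 2 ≤ a ^ 2 := by
    have key : a ^ 2 - (p ^ 2 + (a ^ 2 - b ^ 2) * (x₀ * y₀) ^ 2) =
        (a * x₁ * y₁ - b * x₀ * y₀) ^ 2 + (a ^ 2 - b ^ 2) * (x₀ * y₁) ^ 2 := by
      have : a ^ 2 = a ^ 2 * ((x₀ ^ 2 + x₁ ^ 2) * (y₀ ^ 2 + y₁ ^ 2)) := by
        rw [hx, hy, mul_one, mul_one]
      linear_combination this
    have : 0 ≤ (a ^ 2 - b ^ 2) * (x₀ * y₁) ^ 2 :=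
      mul_nonneg (by nlinarith [sq_nonneg c]) (sq_nonneg _)
    linarith [sq_nonneg (a * x₁ * y₁ - b * x₀ * y₀)]
  calc _ = (p * z₀ + q * z₁) ^ 2 := by ring
    _ ≤ a ^ 2 := by linarith

theorem wForm_sq_le_max {a b c : ℝ} (hnorm : a ^ 2 + b ^ 2 + c ^ 2 = 1)
    (hmax : 1 / 2 ≤ max (a ^ 2) (max (b ^ 2) (c ^ 2))) {x₀ x₁ y₀ y₁ z₀ z₁ : ℝ}
    (hx : x₀ ^ 2 + x₁ ^ 2 = 1) (hy : y₀ ^ 2 + y₁ ^ 2 = 1) (hz : z₀ ^ 2 + z₁ ^ 2 = 1) :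
    (a * (x₁ * y₀ * z₀) + b * (x₀ * y₁ * z₀) + c * (x₀ * y₀ * z₁)) ^ 2 ≤
      max (a ^ 2) (max (b ^ 2) (c ^ 2)) := by
  rcases le_max_iff.1 hmax with h | h
  · exact (wForm_sq_le (by linarith) hx hy hz).trans (le_max_left _ _)
  rcases le_max_iff.1 h with h | h
  · refine le_trans (le_of_eq ?_) ((wForm_sq_le (a := b) (b := a) (c := c) (by linarith)
      hy hx hz).trans ((le_max_left _ _).trans (le_max_right _ _)))
    ring
  · refine le_trans (le_of_eq ?_) ((wForm_sq_le (a := c) (b := b) (c := a) (by linarith)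
      hz hy hx).trans ((le_max_right _ _).trans (le_max_right _ _)))
    ring


open scoped BigOperators

theorem Lmax_W_type_slightly_entangled (a b c : ℝ) (ha : 0 < a) (hb : 0 < b) (hc : 0 < c)
    (hnorm : a ^ 2 + b ^ 2 + c ^ 2 = 1)
    (hmax : 1 / 2 ≤ max (a ^ 2) (max (b ^ 2) (c ^ 2)))
    (ψ : Fin 2 → Fin 2 → Fin 2 → ℂ)
    (h100 : ψ 1 0 0 = (a : ℂ)) (h010 : ψ 0 1 0 = (b : ℂ)) (h001 : ψ 0 0 1 = (c : ℂ))
    (hzero : ∀ i j k : Fin 2, ¬(i = 1 ∧ j = 0 ∧ k = 0) → ¬(i = 0 ∧ j = 1 ∧ k = 0) →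
      ¬(i = 0 ∧ j = 0 ∧ k = 1) → ψ i j k = 0) :
    (Lmax ψ) ^ 2 = max (a ^ 2) (max (b ^ 2) (c ^ 2)) := by
  have hov : ∀ u v w : Fin 2 → ℂ, prodOverlap ψ u v w =
      ‖(starRingEnd ℂ) (u 1) * (starRingEnd ℂ) (v 0) * (starRingEnd ℂ) (w 0) * a +
        (starRingEnd ℂ) (u 0) * (starRingEnd ℂ) (v 1) * (starRingEnd ℂ) (w 0) * b +
        (starRingEnd ℂ) (u 0) * (starRingEnd ℂ) (v 0) * (starRingEnd ℂ) (w 1) * c‖ := by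
    intro u v w
    have h000 := hzero 0 0 0 (by decide) (by decide) (by decide)
    have h011 := hzero 0 1 1 (by decide) (by decide) (by decide)
    have h101 := hzero 1 0 1 (by decide) (by decide) (by decide)
    have h110 := hzero 1 1 0 (by decide) (by decide) (by decide)
    have h111 := hzero 1 1 1 (by decide) (by decide) (by decide)
    unfold prodOverlap
    simp only [Fin.sum_univ_two, h000, h011, h101, h110, h111, h100, h010, h001]
    congr 1
    ring
  set M := max (a ^ 2) (max (b ^ 2) (c ^ 2))
  set S := {r : ℝ | ∃ u v w : Fin 2 → ℂ,
    (∑ i : Fin 2, ‖u i‖ ^ 2) = 1 ∧ (∑ i : Fin 2, ‖v i‖ ^ 2) = 1 ∧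
      (∑ i : Fin 2, ‖w i‖ ^ 2) = 1 ∧ r = prodOverlap ψ u v w}
  have hL : Lmax ψ = sSup S := rfl
  have hub : ∀ r ∈ S, r ≤ √M := by
    rintro r ⟨u, v, w, hu, hv, hw, rfl⟩
    rw [Fin.sum_univ_two] at hu hv hw
    refine le_trans ?_ (Real.le_sqrt_of_sq_le (wForm_sq_le_max hnorm hmax hu hv hw))
    rw [hov]
    refine norm_add₃_le.trans (le_of_eq ?_)
    simp only [norm_mul, RCLike.norm_conj, Complex.norm_real, Real.norm_of_nonneg, ha.le, hb.le,
      hc.le]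
    ring
  have hbdd : BddAbove S := ⟨√M, hub⟩
  have haS : a ∈ S := ⟨![0, 1], ![1, 0], ![1, 0], by simp, by simp, by simp, by
    simp [hov, abs_of_pos ha]⟩
  have hbS : b ∈ S := ⟨![1, 0], ![0, 1], ![1, 0], by simp, by simp, by simp, by
    simp [hov, abs_of_pos hb]⟩
  have hcS : c ∈ S := ⟨![1, 0], ![1, 0], ![0, 1], by simp, by simp, by simp, by
    simp [hov, abs_of_pos hc]⟩
  have hle : sSup S ≤ √M := csSup_le ⟨a, haS⟩ hub
  have haL := le_csSup hbdd haS
  have hbL := le_csSup hbdd hbS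
  have hcL := le_csSup hbdd hcS
  rw [hL]
  apply le_antisymm
  · exact (Real.le_sqrt' (ha.trans_le haL)).1 hle
  · refine max_le ?_ (max_le ?_ ?_) <;> gcongr
end

section
/- Let a, b, c, d be nonnegative real numbers with a² + b² + c² + d² = 1, and let ψ be the three-qubit state with ψ 0 0 0 = a, ψ 1 1 1 = b, ψ 0 0 1 = c, ψ 1 1 0 = d and all other components 0 (a state symmetric under permutation of the first two qubits). Then Λmax(ψ)² = (1 + |a² + c² − b² − d²|)/2. -/
open scoped BigOperators

/-- If `r₀, r₁` are lengths of the components of a unit vector, then `r₀ p + r₁ q` is bounded by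
any `s ≥ 0` with `p² + q² ≤ s²`. -/
theorem mul_add_mul_le_of_sq_add_sq_eq_one {r₀ r₁ p q s : ℝ} (hs : 0 ≤ s)
    (hr : r₀ ^ 2 + r₁ ^ 2 = 1) (hpq : p ^ 2 + q ^ 2 ≤ s ^ 2) : r₀ * p + r₁ * q ≤ s := by
  refine abs_le_of_sq_le_sq' ?_ hs |>.2
  have h : (r₀ * p + r₁ * q) ^ 2 + (r₀ * q - r₁ * p) ^ 2 = p ^ 2 + q ^ 2 := by
    linear_combination (p ^ 2 + q ^ 2) * hr
  nlinarith [sq_nonneg (r₀ * q - r₁ * p)]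

/-- The product overlap of `|00⟩(a|0⟩ + c|1⟩) + |11⟩(d|0⟩ + b|1⟩)`. -/
theorem prodOverlap_symmetric_state (a b c d : ℝ) (ψ : Fin 2 → Fin 2 → Fin 2 → ℂ)
    (h000 : ψ 0 0 0 = (a : ℂ)) (h111 : ψ 1 1 1 = (b : ℂ))
    (h001 : ψ 0 0 1 = (c : ℂ)) (h110 : ψ 1 1 0 = (d : ℂ))
    (hzero : ∀ i j k : Fin 2, ¬(i = 0 ∧ j = 0 ∧ k = 0) → ¬(i = 1 ∧ j = 1 ∧ k = 1) →
      ¬(i = 0 ∧ j = 0 ∧ k = 1) → ¬(i = 1 ∧ j = 1 ∧ k = 0) → ψ i j k = 0)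
    (u v w : Fin 2 → ℂ) :
    prodOverlap ψ u v w =
      ‖(starRingEnd ℂ) (u 0) * (starRingEnd ℂ) (v 0) *
          ((starRingEnd ℂ) (w 0) * a + (starRingEnd ℂ) (w 1) * c) +
        (starRingEnd ℂ) (u 1) * (starRingEnd ℂ) (v 1) *
          ((starRingEnd ℂ) (w 0) * d + (starRingEnd ℂ) (w 1) * b)‖ := by
  have h01 (k : Fin 2) : ψ 0 1 k = 0 := hzero 0 1 k (by simp) (by simp) (by simp) (by simp)
  have h10 (k : Fin 2) : ψ 1 0 k = 0 := hzero 1 0 k (by simp) (by simp) (by simp) (by simp)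
  simp only [prodOverlap, Fin.sum_univ_two, h01, h10, h000, h111, h001, h110]
  congr 1
  ring

/-- The overlap of a unit vector with a vector with nonnegative components of length at most `s`
is at most `s`. -/
theorem norm_conj_mul_add_conj_mul_le {p q s : ℝ} (hp : 0 ≤ p) (hq : 0 ≤ q) (hs : 0 ≤ s)
    (hpq : p ^ 2 + q ^ 2 ≤ s ^ 2) {w : Fin 2 → ℂ} (hw : ∑ i, ‖w i‖ ^ 2 = 1) :
    ‖(starRingEnd ℂ) (w 0) * p + (starRingEnd ℂ) (w 1) * q‖ ≤ s := by
  rw [Fin.sum_univ_two] at hw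
  refine (norm_add_le _ _).trans ?_
  simpa [abs_of_nonneg hp, abs_of_nonneg hq] using
    mul_add_mul_le_of_sq_add_sq_eq_one hs hw hpq

theorem Lmax_symmetric_state (a b c d : ℝ) (ha : 0 ≤ a) (hb : 0 ≤ b) (hc : 0 ≤ c) (hd : 0 ≤ d)
    (hnorm : a ^ 2 + b ^ 2 + c ^ 2 + d ^ 2 = 1)
    (ψ : Fin 2 → Fin 2 → Fin 2 → ℂ)
    (h000 : ψ 0 0 0 = (a : ℂ)) (h111 : ψ 1 1 1 = (b : ℂ))
    (h001 : ψ 0 0 1 = (c : ℂ)) (h110 : ψ 1 1 0 = (d : ℂ))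
    (hzero : ∀ i j k : Fin 2, ¬(i = 0 ∧ j = 0 ∧ k = 0) → ¬(i = 1 ∧ j = 1 ∧ k = 1) →
      ¬(i = 0 ∧ j = 0 ∧ k = 1) → ¬(i = 1 ∧ j = 1 ∧ k = 0) → ψ i j k = 0) :
    (Lmax ψ) ^ 2 = (1 + |a ^ 2 + c ^ 2 - b ^ 2 - d ^ 2|) / 2 := by
  have hoverlap := prodOverlap_symmetric_state a b c d ψ h000 h111 h001 h110 hzero
  set M : ℝ := (1 + |a ^ 2 + c ^ 2 - b ^ 2 - d ^ 2|) / 2 with hM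
  have hMpos : 0 < M := by positivity
  have hspos : 0 < √M := Real.sqrt_pos.2 hMpos
  have hs : √M ^ 2 = M := Real.sq_sqrt hMpos.le
  have hp : a ^ 2 + c ^ 2 ≤ √M ^ 2 := by
    linarith [le_abs_self (a ^ 2 + c ^ 2 - b ^ 2 - d ^ 2)]
  have hq : d ^ 2 + b ^ 2 ≤ √M ^ 2 := by
    linarith [neg_abs_le (a ^ 2 + c ^ 2 - b ^ 2 - d ^ 2)]
  suffices h : IsGreatest {r : ℝ | ∃ u v w : Fin 2 → ℂ,
      (∑ i : Fin 2, ‖u i‖ ^ 2) = 1 ∧ (∑ i : Fin 2, ‖v i‖ ^ 2) = 1 ∧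
        (∑ i : Fin 2, ‖w i‖ ^ 2) = 1 ∧ r = prodOverlap ψ u v w} √M by
    rw [Lmax, h.csSup_eq, hs]
  have hunit {x y : ℝ} (h : x ^ 2 + y ^ 2 = √M ^ 2) :
      ∑ i, ‖(![(x / √M : ℝ), (y / √M : ℝ)] : Fin 2 → ℂ) i‖ ^ 2 = 1 := by
    simp only [Fin.sum_univ_two, Matrix.cons_val_zero, Matrix.cons_val_one, Complex.norm_real,
      Real.norm_eq_abs, sq_abs]
    rw [div_pow, div_pow, ← add_div, h, div_self (by positivity)]
  have hattain {x y : ℝ} (h : x ^ 2 + y ^ 2 = √M ^ 2) :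
      √M = ‖(((x / √M : ℝ) : ℂ) * x + ((y / √M : ℝ) : ℂ) * y)‖ := by
    have hxy : x / √M * x + y / √M * y = √M := by
      field_simp
      exact h
    rw [← Complex.ofReal_mul, ← Complex.ofReal_mul, ← Complex.ofReal_add, hxy,
      Complex.norm_real, Real.norm_of_nonneg hspos.le]
  constructor
  · rcases le_total 0 (a ^ 2 + c ^ 2 - b ^ 2 - d ^ 2) with h | h
    · have hac : a ^ 2 + c ^ 2 = √M ^ 2 := by
        rw [hs, hM, abs_of_nonneg h]
        linarith
      refine ⟨![1, 0], ![1, 0], _, by simp, by simp, hunit hac, ?_⟩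
      rw [hoverlap]
      simpa using hattain hac
    · have hdb : d ^ 2 + b ^ 2 = √M ^ 2 := by
        rw [hs, hM, abs_of_nonpos h]
        linarith
      refine ⟨![0, 1], ![0, 1], _, by simp, by simp, hunit hdb, ?_⟩
      rw [hoverlap]
      simpa using hattain hdb
  · rintro r ⟨u, v, w, hu, hv, hw, rfl⟩
    have hA := norm_conj_mul_add_conj_mul_le ha hc hspos.le hp hw
    have hB := norm_conj_mul_add_conj_mul_le hd hb hspos.le hq hw
    rw [Fin.sum_univ_two] at hu hv
    rw [hoverlap]
    calc
      _ ≤ ‖u 0‖ * ‖v 0‖ * √M + ‖u 1‖ * ‖v 1‖ * √M := by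
        refine (norm_add_le _ _).trans ?_
        simp only [norm_mul _ (_ + _), norm_mul (starRingEnd ℂ _), RCLike.norm_conj]
        gcongr
      _ = (‖u 0‖ * ‖v 0‖ + ‖u 1‖ * ‖v 1‖) * √M := by ring
      _ ≤ 1 * √M := by
        gcongr
        exact mul_add_mul_le_of_sq_add_sq_eq_one zero_le_one hu (by rw [hv, one_pow])
      _ = √M := one_mul _
end

section
/- Let q₁, q₂ : Fin 2 → ℂ be unit vectors and let k₁, k₂ be nonnegative reals with k₁² + k₂² = 1. Let ψ be the three-qubit state defined by ψ 0 0 k = k₁ · q₁ k and ψ 1 1 k = k₂ · q₂ k for k ∈ Fin 2, and ψ i j k = 0 whenever i ≠ j (i.e. ψ = k₁|00⟩⊗q₁ + k₂|11⟩⊗q₂). Then Λmax(ψ)² = max(k₁², k₂²); in particular Λmax does not depend on the single-qubit states q₁, q₂. -/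
open scoped BigOperators

/-- The Cauchy–Schwarz inequality for two unit vectors. -/
theorem norm_sum_conj_mul_le_one {ι : Type*} [Fintype ι] {a b : ι → ℂ}
    (ha : (∑ i, ‖a i‖ ^ 2) = 1) (hb : (∑ i, ‖b i‖ ^ 2) = 1) :
    ‖∑ i, (starRingEnd ℂ) (a i) * b i‖ ≤ 1 := by
  have hle : (∑ i, ‖a i‖ * ‖b i‖) ^ 2 ≤ 1 := by
    simpa [ha, hb] using
      Finset.sum_mul_sq_le_sq_mul_sq Finset.univ (fun i => ‖a i‖) (fun i => ‖b i‖)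
  calc ‖∑ i, (starRingEnd ℂ) (a i) * b i‖ ≤ ∑ i, ‖a i‖ * ‖b i‖ :=
        norm_sum_le_of_le _ fun i _ => by simp
    _ ≤ 1 := (abs_le_of_sq_le_sq' (by simpa using hle) zero_le_one).2

/-- The inner product of a unit vector with itself is `1`. -/
theorem sum_conj_mul_self_eq_one {ι : Type*} [Fintype ι] {a : ι → ℂ}
    (ha : (∑ i, ‖a i‖ ^ 2) = 1) : ∑ i, (starRingEnd ℂ) (a i) * a i = 1 := by
  simp only [Complex.conj_mul']
  exact_mod_cast ha

/-- The product overlap of a state supported on `|00⟩` and `|11⟩` in its first two qubits. -/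
theorem prodOverlap_schmidt_like {ψ : Fin 2 → Fin 2 → Fin 2 → ℂ} {q₁ q₂ : Fin 2 → ℂ} {k₁ k₂ : ℝ}
    (h00 : ∀ k : Fin 2, ψ 0 0 k = (k₁ : ℂ) * q₁ k)
    (h11 : ∀ k : Fin 2, ψ 1 1 k = (k₂ : ℂ) * q₂ k)
    (hzero : ∀ i j k : Fin 2, i ≠ j → ψ i j k = 0) (u v w : Fin 2 → ℂ) :
    prodOverlap ψ u v w =
      ‖k₁ * ((starRingEnd ℂ) (u 0) * (starRingEnd ℂ) (v 0)) *
          (∑ k, (starRingEnd ℂ) (w k) * q₁ k) +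
        k₂ * ((starRingEnd ℂ) (u 1) * (starRingEnd ℂ) (v 1)) *
          (∑ k, (starRingEnd ℂ) (w k) * q₂ k)‖ := by
  unfold prodOverlap
  congr 1
  simp only [Fin.sum_univ_two, h00, h11, hzero 0 1 _ (by decide), hzero 1 0 _ (by decide)]
  ring

theorem prodOverlap_schmidt_like_le {ψ : Fin 2 → Fin 2 → Fin 2 → ℂ} {q₁ q₂ : Fin 2 → ℂ}
    (hq₁ : (∑ i : Fin 2, ‖q₁ i‖ ^ 2) = 1) (hq₂ : (∑ i : Fin 2, ‖q₂ i‖ ^ 2) = 1)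
    {k₁ k₂ : ℝ} (hk₁ : 0 ≤ k₁) (hk₂ : 0 ≤ k₂)
    (h00 : ∀ k : Fin 2, ψ 0 0 k = (k₁ : ℂ) * q₁ k)
    (h11 : ∀ k : Fin 2, ψ 1 1 k = (k₂ : ℂ) * q₂ k)
    (hzero : ∀ i j k : Fin 2, i ≠ j → ψ i j k = 0) {u v w : Fin 2 → ℂ}
    (hu : (∑ i : Fin 2, ‖u i‖ ^ 2) = 1) (hv : (∑ i : Fin 2, ‖v i‖ ^ 2) = 1)
    (hw : (∑ i : Fin 2, ‖w i‖ ^ 2) = 1) :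
    prodOverlap ψ u v w ≤ max k₁ k₂ := by
  have hm : 0 ≤ max k₁ k₂ := le_max_of_le_left hk₁
  have huv : ‖u 0‖ * ‖v 0‖ + ‖u 1‖ * ‖v 1‖ ≤ 1 := by
    rw [Fin.sum_univ_two] at hu hv
    nlinarith [sq_nonneg (‖u 0‖ - ‖v 0‖), sq_nonneg (‖u 1‖ - ‖v 1‖)]
  rw [prodOverlap_schmidt_like h00 h11 hzero]
  calc _ ≤ k₁ * (‖u 0‖ * ‖v 0‖) * ‖∑ k, (starRingEnd ℂ) (w k) * q₁ k‖ +
        k₂ * (‖u 1‖ * ‖v 1‖) * ‖∑ k, (starRingEnd ℂ) (w k) * q₂ k‖ := by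
        refine (norm_add_le _ _).trans_eq ?_
        simp only [norm_mul, Complex.norm_conj, Complex.norm_of_nonneg hk₁,
          Complex.norm_of_nonneg hk₂]
    _ ≤ max k₁ k₂ * (‖u 0‖ * ‖v 0‖) * 1 + max k₁ k₂ * (‖u 1‖ * ‖v 1‖) * 1 := by
        gcongr
        · exact le_max_left _ _
        · exact norm_sum_conj_mul_le_one hw hq₁
        · exact le_max_right _ _
        · exact norm_sum_conj_mul_le_one hw hq₂
    _ = max k₁ k₂ * (‖u 0‖ * ‖v 0‖ + ‖u 1‖ * ‖v 1‖) := by ring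
    _ ≤ max k₁ k₂ := mul_le_of_le_one_right hm huv

theorem Lmax_eq_max_of_schmidt_like {ψ : Fin 2 → Fin 2 → Fin 2 → ℂ} {q₁ q₂ : Fin 2 → ℂ}
    (hq₁ : (∑ i : Fin 2, ‖q₁ i‖ ^ 2) = 1) (hq₂ : (∑ i : Fin 2, ‖q₂ i‖ ^ 2) = 1)
    {k₁ k₂ : ℝ} (hk₁ : 0 ≤ k₁) (hk₂ : 0 ≤ k₂)
    (h00 : ∀ k : Fin 2, ψ 0 0 k = (k₁ : ℂ) * q₁ k)
    (h11 : ∀ k : Fin 2, ψ 1 1 k = (k₂ : ℂ) * q₂ k)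
    (hzero : ∀ i j k : Fin 2, i ≠ j → ψ i j k = 0) :
    Lmax ψ = max k₁ k₂ := by
  refine IsGreatest.csSup_eq ⟨?_, ?_⟩
  · rcases max_choice k₁ k₂ with h | h <;> rw [h]
    · refine ⟨Pi.single 0 1, Pi.single 0 1, q₁, by simp, by simp, hq₁, ?_⟩
      rw [prodOverlap_schmidt_like h00 h11 hzero, sum_conj_mul_self_eq_one hq₁]
      simp [abs_of_nonneg hk₁]
    · refine ⟨Pi.single 1 1, Pi.single 1 1, q₂, by simp, by simp, hq₂, ?_⟩
      rw [prodOverlap_schmidt_like h00 h11 hzero, sum_conj_mul_self_eq_one hq₂]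
      simp [abs_of_nonneg hk₂]
  · rintro r ⟨u, v, w, hu, hv, hw, rfl⟩
    exact prodOverlap_schmidt_like_le hq₁ hq₂ hk₁ hk₂ h00 h11 hzero hu hv hw

theorem Lmax_schmidt_like_state (q₁ q₂ : Fin 2 → ℂ)
    (hq₁ : (∑ i : Fin 2, ‖q₁ i‖ ^ 2) = 1) (hq₂ : (∑ i : Fin 2, ‖q₂ i‖ ^ 2) = 1)
    (k₁ k₂ : ℝ) (hk₁ : 0 ≤ k₁) (hk₂ : 0 ≤ k₂) (hnorm : k₁ ^ 2 + k₂ ^ 2 = 1)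
    (ψ : Fin 2 → Fin 2 → Fin 2 → ℂ)
    (h00 : ∀ k : Fin 2, ψ 0 0 k = (k₁ : ℂ) * q₁ k)
    (h11 : ∀ k : Fin 2, ψ 1 1 k = (k₂ : ℂ) * q₂ k)
    (hzero : ∀ i j k : Fin 2, i ≠ j → ψ i j k = 0) :
    (Lmax ψ) ^ 2 = max (k₁ ^ 2) (k₂ ^ 2) := by
  rw [Lmax_eq_max_of_schmidt_like hq₁ hq₂ hk₁ hk₂ h00 h11 hzero]
  rcases le_total k₁ k₂ with h | h
  · rw [max_eq_right h, max_eq_right (by gcongr)]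
  · rw [max_eq_left h, max_eq_left (by gcongr)]
end

section
/- Let a, b, c, d be positive real numbers with a² + b² + c² + d² = 1, let l = max(a, b, c, d), and suppose l⁴ ≤ l²/2 + a·b·c·d. Let ψ be the three-qubit state with ψ 1 0 0 = a, ψ 0 1 0 = b, ψ 0 0 1 = c, ψ 1 1 1 = d and all other components 0. Then Λmax(ψ)² = 4·(a·b + c·d)·(a·c + b·d)·(a·d + b·c) / ((−a+b+c+d)·(a−b+c+d)·(a+b−c+d)·(a+b+c−d)), i.e. Λmax(ψ)² is the squared diameter of the circumcircle of the cyclic convex quadrangle with sides a, b, c, d. -/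
/-- Sixteen times the squared area of the cyclic quadrangle with sides `a, b, c, d`. -/
def brahmagupta (a b c d : ℝ) : ℝ :=
  (-a + b + c + d) * (a - b + c + d) * (a + b - c + d) * (a + b + c - d)

/-- For a cyclic quadrangle with sides `a, b, c, d` and area `K`, this is `8 * K` times the
signed distance from the circumcentre to the side `a`. -/
def sideCofactor (a b c d : ℝ) : ℝ :=
  a * (b ^ 2 + c ^ 2 + d ^ 2 - a ^ 2) + 2 * b * c * d

lemma sideCofactor_nonneg {a b c d : ℝ} (ha : 0 < a)
    (h : a ^ 4 ≤ a ^ 2 * (a ^ 2 + b ^ 2 + c ^ 2 + d ^ 2) / 2 + a * b * c * d) :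
    0 ≤ sideCofactor a b c d := by
  refine nonneg_of_mul_nonneg_right (?_ : 0 ≤ a * sideCofactor a b c d) ha
  unfold sideCofactor
  linarith

lemma lt_add_of_sideCofactor_nonneg {a b c d : ℝ} (hb : 0 < b) (hc : 0 < c)
    (hd : 0 < d) (h : 0 ≤ sideCofactor a b c d) : a < b + c + d := by
  by_contra! hle
  have hbc := mul_pos hb hc
  have hbd := mul_pos hb hd
  have hcd := mul_pos hc hd
  have ha : 0 < a := by linarith
  have hda : b * c * d < b * c * a := mul_lt_mul_of_pos_left (by linarith) hbc
  have hsq : (b + c + d) ^ 2 ≤ a ^ 2 := pow_le_pow_left₀ (by positivity) hle 2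
  have := mul_le_mul_of_nonneg_left hsq ha.le
  unfold sideCofactor at h
  nlinarith [mul_pos ha hbd, mul_pos ha hcd]

lemma sideCofactor_mul_add_mul (a b c d : ℝ) :
    sideCofactor a b c d * sideCofactor d a b c + sideCofactor b a c d * sideCofactor c a b d =
      brahmagupta a b c d * (a * d + b * c) := by
  unfold sideCofactor brahmagupta
  ring

lemma sideCofactor_sq (a b c d : ℝ) :
    sideCofactor a b c d ^ 2 = 4 * (a * b + c * d) * (a * c + b * d) * (a * d + b * c) -
      brahmagupta a b c d * a ^ 2 := by
  unfold sideCofactor brahmagupta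
  ring

lemma sum_mul_sideCofactor (a b c d : ℝ) :
    a * (sideCofactor b a c d * sideCofactor c a b d * sideCofactor d a b c) +
      b * (sideCofactor a b c d * sideCofactor c a b d * sideCofactor d a b c) +
      c * (sideCofactor a b c d * sideCofactor b a c d * sideCofactor d a b c) +
      d * (sideCofactor a b c d * sideCofactor b a c d * sideCofactor c a b d) =
      2 * brahmagupta a b c d * ((a * b + c * d) * (a * c + b * d) * (a * d + b * c)) := by
  unfold sideCofactor brahmagupta
  ring

/-- A binary quadratic form with nonnegative diagonal and determinant is nonnegative. -/
lemma binary_form_nonneg {α β γ x y : ℝ} (hα : 0 ≤ α) (hβ : 0 ≤ β) (h : γ ^ 2 ≤ α * β) :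
    0 ≤ α * x ^ 2 - 2 * γ * (x * y) + β * y ^ 2 := by
  rcases hα.eq_or_lt with rfl | hα
  · have : γ = 0 := by nlinarith [sq_nonneg γ]
    subst this
    nlinarith [mul_nonneg hβ (sq_nonneg y)]
  · refine nonneg_of_mul_nonneg_right (?_ : 0 ≤ α * _) hα
    nlinarith [sq_nonneg (α * x - γ * y), mul_nonneg (sub_nonneg.2 h) (sq_nonneg y)]

/-- The squared overlap maximized over the last qubit, bounded for real vectors. -/
lemma sq_add_sq_le_quadrangle (a b c d u₀ u₁ v₀ v₁ : ℝ) :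
    brahmagupta a b c d *
        ((a * u₁ * v₀ + b * u₀ * v₁) ^ 2 + (c * u₀ * v₀ + d * u₁ * v₁) ^ 2) ≤
      4 * (a * b + c * d) * (a * c + b * d) * (a * d + b * c) *
        ((u₀ ^ 2 + u₁ ^ 2) * (v₀ ^ 2 + v₁ ^ 2)) := by
  have hperm : sideCofactor c a b d * sideCofactor d a b c +
      sideCofactor a b c d * sideCofactor b a c d = brahmagupta a b c d * (a * b + c * d) := by
    unfold sideCofactor brahmagupta
    ring
  have h := binary_form_nonneg (x := v₀) (y := v₁)
    (α := (sideCofactor c a b d * u₀) ^ 2 + (sideCofactor a b c d * u₁) ^ 2)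
    (β := (sideCofactor b a c d * u₀) ^ 2 + (sideCofactor d a b c * u₁) ^ 2)
    (γ := brahmagupta a b c d * (a * b + c * d) * (u₀ * u₁))
    (by positivity) (by positivity) (by
      rw [← hperm]
      linarith [sq_nonneg (sideCofactor b a c d * sideCofactor c a b d * u₀ ^ 2 -
        sideCofactor a b c d * sideCofactor d a b c * u₁ ^ 2)])
  simp only [mul_pow, sideCofactor_sq] at h
  have hb : brahmagupta b a c d = brahmagupta a b c d := by unfold brahmagupta; ring
  have hc : brahmagupta c a b d = brahmagupta a b c d := by unfold brahmagupta; ring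
  have hd : brahmagupta d a b c = brahmagupta a b c d := by unfold brahmagupta; ring
  rw [hb, hc, hd] at h
  linarith


open scoped BigOperators

theorem Lmax_convex_quadrangle (a b c d : ℝ) (ha : 0 < a) (hb : 0 < b) (hc : 0 < c) (hd : 0 < d)
    (hnorm : a ^ 2 + b ^ 2 + c ^ 2 + d ^ 2 = 1)
    (l : ℝ) (hl : l = max (max a b) (max c d))
    (hcond : l ^ 4 ≤ l ^ 2 / 2 + a * b * c * d)
    (ψ : Fin 2 → Fin 2 → Fin 2 → ℂ)
    (h100 : ψ 1 0 0 = (a : ℂ)) (h010 : ψ 0 1 0 = (b : ℂ))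
    (h001 : ψ 0 0 1 = (c : ℂ)) (h111 : ψ 1 1 1 = (d : ℂ))
    (hzero : ∀ i j k : Fin 2, ¬(i = 1 ∧ j = 0 ∧ k = 0) → ¬(i = 0 ∧ j = 1 ∧ k = 0) →
      ¬(i = 0 ∧ j = 0 ∧ k = 1) → ¬(i = 1 ∧ j = 1 ∧ k = 1) → ψ i j k = 0) :
    (Lmax ψ) ^ 2 =
      4 * (a * b + c * d) * (a * c + b * d) * (a * d + b * c) /
        ((-a + b + c + d) * (a - b + c + d) * (a + b - c + d) * (a + b + c - d)) := by
  have hN' : brahmagupta a b c d =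
    (-a + b + c + d) * (a - b + c + d) * (a + b - c + d) * (a + b + c - d) := rfl
  have hmono : ∀ x, 0 < x → x ≤ l → x ^ 4 ≤ x ^ 2 * 1 / 2 + a * b * c * d := by
    intro x hx hxl
    have habcd : 0 < a * b * c * d := by positivity
    have hsq : x ^ 2 ≤ l ^ 2 := pow_le_pow_left₀ hx.le hxl 2
    rcases le_total (x ^ 2) (1 / 2) with h | h
    · nlinarith [sq_nonneg x]
    · nlinarith [mul_nonneg (sub_nonneg.2 hsq) (by linarith : 0 ≤ l ^ 2 + x ^ 2 - 1 / 2)]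
  have hga : 0 ≤ sideCofactor a b c d := sideCofactor_nonneg ha (by
    rw [hnorm]; exact hmono a ha (by simp [hl]))
  have hgb : 0 ≤ sideCofactor b a c d := sideCofactor_nonneg hb (by
    linear_combination hmono b hb (by simp [hl]) - b ^ 2 / 2 * hnorm)
  have hgc : 0 ≤ sideCofactor c a b d := sideCofactor_nonneg hc (by
    linear_combination hmono c hc (by simp [hl]) - c ^ 2 / 2 * hnorm)
  have hgd : 0 ≤ sideCofactor d a b c := sideCofactor_nonneg hd (by
    linear_combination hmono d hd (by simp [hl]) - d ^ 2 / 2 * hnorm)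
  have hN : 0 < brahmagupta a b c d := by
    have h₁ := lt_add_of_sideCofactor_nonneg hb hc hd hga
    have h₂ := lt_add_of_sideCofactor_nonneg ha hc hd hgb
    have h₃ := lt_add_of_sideCofactor_nonneg ha hb hd hgc
    have h₄ := lt_add_of_sideCofactor_nonneg ha hb hc hgd
    exact mul_pos (mul_pos (mul_pos (by linarith) (by linarith)) (by linarith)) (by linarith)
  rw [← hN']
  have hoverlap : ∀ u v w : Fin 2 → ℂ, prodOverlap ψ u v w =
      ‖(starRingEnd ℂ) (a * (u 1 * v 0 * w 0) + b * (u 0 * v 1 * w 0) + c * (u 0 * v 0 * w 1) +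
        d * (u 1 * v 1 * w 1))‖ := by
    intro u v w
    have h000 : ψ 0 0 0 = 0 := hzero 0 0 0 (by simp) (by simp) (by simp) (by simp)
    have h011 : ψ 0 1 1 = 0 := hzero 0 1 1 (by simp) (by simp) (by simp) (by simp)
    have h101 : ψ 1 0 1 = 0 := hzero 1 0 1 (by simp) (by simp) (by simp) (by simp)
    have h110 : ψ 1 1 0 = 0 := hzero 1 1 0 (by simp) (by simp) (by simp) (by simp)
    simp only [prodOverlap, Fin.sum_univ_two, h000, h001, h010, h011, h100, h101, h110, h111,
      map_add, map_mul, Complex.conj_ofReal]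
    congr 1
    ring
  have hgreatest : IsGreatest {r : ℝ | ∃ u v w : Fin 2 → ℂ,
      (∑ i : Fin 2, ‖u i‖ ^ 2) = 1 ∧ (∑ i : Fin 2, ‖v i‖ ^ 2) = 1 ∧
        (∑ i : Fin 2, ‖w i‖ ^ 2) = 1 ∧ r = prodOverlap ψ u v w}
      (√(4 * (a * b + c * d) * (a * c + b * d) * (a * d + b * c) / brahmagupta a b c d)) := by
    constructor
    · have h₁ := sideCofactor_mul_add_mul a b c d
      have h₂ : sideCofactor b a c d * sideCofactor d a b c +
          sideCofactor a b c d * sideCofactor c a b d =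
          brahmagupta a b c d * (a * c + b * d) := by
        unfold sideCofactor brahmagupta
        ring
      have h₃ : sideCofactor c a b d * sideCofactor d a b c +
          sideCofactor a b c d * sideCofactor b a c d =
          brahmagupta a b c d * (a * b + c * d) := by
        unfold sideCofactor brahmagupta
        ring
      have hsum := sum_mul_sideCofactor a b c d
      generalize brahmagupta a b c d = N at *
      obtain ⟨p, hp, hpa⟩ : ∃ p, 0 ≤ p ∧ p ^ 2 = sideCofactor a b c d :=
        ⟨_, Real.sqrt_nonneg _, Real.sq_sqrt hga⟩
      obtain ⟨q, hq, hqb⟩ : ∃ q, 0 ≤ q ∧ q ^ 2 = sideCofactor b a c d :=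
        ⟨_, Real.sqrt_nonneg _, Real.sq_sqrt hgb⟩
      obtain ⟨r, hr, hrc⟩ : ∃ r, 0 ≤ r ∧ r ^ 2 = sideCofactor c a b d :=
        ⟨_, Real.sqrt_nonneg _, Real.sq_sqrt hgc⟩
      obtain ⟨s, hs, hsd⟩ : ∃ s, 0 ≤ s ∧ s ^ 2 = sideCofactor d a b c :=
        ⟨_, Real.sqrt_nonneg _, Real.sq_sqrt hgd⟩
      rw [← hpa, ← hqb, ← hrc, ← hsd] at h₁ h₂ h₃ hsum
      obtain ⟨x, hx, hx2⟩ : ∃ x, 0 < x ∧ x ^ 2 = N * (a * d + b * c) :=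
        ⟨_, Real.sqrt_pos.2 (by positivity), Real.sq_sqrt (by positivity)⟩
      obtain ⟨y, hy, hy2⟩ : ∃ y, 0 < y ∧ y ^ 2 = N * (a * c + b * d) :=
        ⟨_, Real.sqrt_pos.2 (by positivity), Real.sq_sqrt (by positivity)⟩
      obtain ⟨z, hz, hz2⟩ : ∃ z, 0 < z ∧ z ^ 2 = N * (a * b + c * d) :=
        ⟨_, Real.sqrt_pos.2 (by positivity), Real.sq_sqrt (by positivity)⟩
      have hunit : ∀ m n t : ℝ, 0 < t → m ^ 2 + n ^ 2 = t ^ 2 →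
          ∑ i : Fin 2, ‖(![((m / t : ℝ) : ℂ), ((n / t : ℝ) : ℂ)] : Fin 2 → ℂ) i‖ ^ 2 = 1 := by
        intro m n t ht h
        simp only [Fin.sum_univ_two, Matrix.cons_val_zero, Matrix.cons_val_one,
          Complex.norm_real, Real.norm_eq_abs, sq_abs, div_pow]
        rw [← add_div, h, div_self (by positivity)]
      refine ⟨_, _, _, hunit (p * s) (q * r) x hx (by linarith),
        hunit (q * s) (p * r) y hy (by linarith), hunit (r * s) (p * q) z hz (by linarith), ?_⟩
      rw [hoverlap, RCLike.norm_conj]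
      simp only [Matrix.cons_val_zero, Matrix.cons_val_one]
      norm_cast
      rw [Real.norm_eq_abs, ← Real.sqrt_sq_eq_abs]
      congr 1
      have hval : a * (q * r / x * (q * s / y) * (r * s / z)) +
          b * (p * s / x * (p * r / y) * (r * s / z)) +
          c * (p * s / x * (q * s / y) * (p * q / z)) +
          d * (q * r / x * (p * r / y) * (p * q / z)) =
          2 * N * ((a * b + c * d) * (a * c + b * d) * (a * d + b * c)) / (x * y * z) := by
        rw [← hsum]
        field_simp
      rw [hval, div_pow, mul_pow, mul_pow (x * y), mul_pow x, hx2, hy2, hz2]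
      field_simp
      ring
    · rintro _ ⟨u, v, w, hu, hv, hw, rfl⟩
      rw [Fin.sum_univ_two] at hu hv hw
      rw [hoverlap, RCLike.norm_conj]
      apply Real.le_sqrt_of_sq_le
      rw [le_div_iff₀ hN]
      have htri : ‖(a * (u 1 * v 0 * w 0) + b * (u 0 * v 1 * w 0) + c * (u 0 * v 0 * w 1) +
          d * (u 1 * v 1 * w 1) : ℂ)‖ ≤ (a * ‖u 1‖ * ‖v 0‖ + b * ‖u 0‖ * ‖v 1‖) * ‖w 0‖ +
          (c * ‖u 0‖ * ‖v 0‖ + d * ‖u 1‖ * ‖v 1‖) * ‖w 1‖ := by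
        refine (norm_add₄_le).trans (le_of_eq ?_)
        simp only [norm_mul, Complex.norm_real, Real.norm_eq_abs, abs_of_pos ha, abs_of_pos hb,
          abs_of_pos hc, abs_of_pos hd]
        ring
      have hbound := sq_add_sq_le_quadrangle a b c d ‖u 0‖ ‖u 1‖ ‖v 0‖ ‖v 1‖
      rw [hu, hv, mul_one, mul_one] at hbound
      refine le_trans ?_ hbound
      rw [mul_comm]
      refine mul_le_mul_of_nonneg_left ((pow_le_pow_left₀ (norm_nonneg _) htri 2).trans ?_) hN.le
      generalize a * ‖u 1‖ * ‖v 0‖ + b * ‖u 0‖ * ‖v 1‖ = P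
      generalize c * ‖u 0‖ * ‖v 0‖ + d * ‖u 1‖ * ‖v 1‖ = Q
      linear_combination sq_nonneg (P * ‖w 1‖ - Q * ‖w 0‖) + (P ^ 2 + Q ^ 2) * hw
  rw [Lmax, hgreatest.csSup_eq, Real.sq_sqrt (by positivity)]
end

section
/- Let a, b, c, d be positive real numbers with a² + b² + c² + d² = 1, let l = max(a, b, c, d), and suppose l⁴ ≥ l²/2 + a·b·c·d. Let ψ be the three-qubit state with ψ 1 0 0 = a, ψ 0 1 0 = b, ψ 0 0 1 = c, ψ 1 1 1 = d and all other components 0. Then Λmax(ψ)² = l², the square of the largest coefficient. -/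
open scoped BigOperators

/-- A trilinear form on real unit vectors with the four coefficients `a, b, c, d` is bounded by its
largest coefficient `d` when `d ^ 4 ≥ d ^ 2 / 2 + a * b * c * d`. -/
theorem trilinear_le_of_largest_coefficient {a b c d x₀ x₁ y₀ y₁ z₀ z₁ : ℝ}
    (ha : 0 < a) (hb : 0 < b) (hc : 0 < c) (hd : 0 < d)
    (hnorm : a ^ 2 + b ^ 2 + c ^ 2 + d ^ 2 = 1) (had : a ≤ d) (hbd : b ≤ d) (hcd : c ≤ d)
    (hcond : d ^ 2 / 2 + a * b * c * d ≤ d ^ 4)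
    (hx : x₀ ^ 2 + x₁ ^ 2 = 1) (hy : y₀ ^ 2 + y₁ ^ 2 = 1) (hz : z₀ ^ 2 + z₁ ^ 2 = 1) :
    a * (x₁ * y₀ * z₀) + b * (x₀ * y₁ * z₀) + c * (x₀ * y₀ * z₁) + d * (x₁ * y₁ * z₁) ≤ d := by
  have hA : 0 ≤ d ^ 2 - a ^ 2 := by nlinarith
  have hB : 0 ≤ d ^ 2 - b ^ 2 := by nlinarith
  have hC : 0 ≤ d ^ 2 - c ^ 2 := by nlinarith
  have hdisc : (a * d + b * c) ^ 2 ≤ (d ^ 2 - c ^ 2) * (d ^ 2 - b ^ 2) := by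
    have : d ^ 2 * (a ^ 2 + b ^ 2 + c ^ 2 + d ^ 2) = d ^ 2 := by rw [hnorm, mul_one]
    nlinarith
  have hquad (s t : ℝ) :
      2 * (a * d + b * c) * (s * t) ≤ (d ^ 2 - c ^ 2) * s ^ 2 + (d ^ 2 - b ^ 2) * t ^ 2 := by
    have h₁ : ((a * d + b * c) * (s * t)) ^ 2 ≤
        ((d ^ 2 - c ^ 2) * s ^ 2) * ((d ^ 2 - b ^ 2) * t ^ 2) := by
      nlinarith [mul_le_mul_of_nonneg_right hdisc (sq_nonneg (s * t))]
    have h₂ : 0 ≤ (d ^ 2 - c ^ 2) * s ^ 2 := by positivity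
    have h₃ : 0 ≤ (d ^ 2 - b ^ 2) * t ^ 2 := by positivity
    rw [mul_assoc]
    refine abs_le_of_sq_le_sq' ?_ (add_nonneg h₂ h₃) |>.2
    nlinarith [sq_nonneg ((d ^ 2 - c ^ 2) * s ^ 2 - (d ^ 2 - b ^ 2) * t ^ 2)]
  have hyz : (a * (y₀ * z₀) + d * (y₁ * z₁)) ^ 2 + (b * (y₁ * z₀) + c * (y₀ * z₁)) ^ 2 ≤ d ^ 2 := by
    have h : d ^ 2 * ((y₀ ^ 2 + y₁ ^ 2) * (z₀ ^ 2 + z₁ ^ 2)) = d ^ 2 := by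
      rw [hy, hz, mul_one, mul_one]
    nlinarith [hquad (y₀ * z₁) (y₁ * z₀), mul_nonneg hA (sq_nonneg (y₀ * z₀))]
  set p := a * (y₀ * z₀) + d * (y₁ * z₁)
  set q := b * (y₁ * z₀) + c * (y₀ * z₁)
  have hpq : (x₁ * p + x₀ * q) ^ 2 ≤ d ^ 2 := by
    have h : (x₀ ^ 2 + x₁ ^ 2) * (p ^ 2 + q ^ 2) = p ^ 2 + q ^ 2 := by rw [hx, one_mul]
    nlinarith [sq_nonneg (x₁ * q - x₀ * p)]
  calc _ = x₁ * p + x₀ * q := by ring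
    _ ≤ d := (abs_le_of_sq_le_sq' hpq hd.le).2

/-- The overlap of a state with a product of computational basis vectors is the modulus of the
corresponding component. -/
theorem prodOverlap_single (ψ : Fin 2 → Fin 2 → Fin 2 → ℂ) (i j k : Fin 2) :
    prodOverlap ψ (Pi.single i 1) (Pi.single j 1) (Pi.single k 1) = ‖ψ i j k‖ := by
  fin_cases i <;> fin_cases j <;> fin_cases k <;> simp [prodOverlap]

theorem Lmax_largest_coefficient (a b c d : ℝ) (ha : 0 < a) (hb : 0 < b) (hc : 0 < c) (hd : 0 < d)
    (hnorm : a ^ 2 + b ^ 2 + c ^ 2 + d ^ 2 = 1)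
    (l : ℝ) (hl : l = max (max a b) (max c d))
    (hcond : l ^ 2 / 2 + a * b * c * d ≤ l ^ 4)
    (ψ : Fin 2 → Fin 2 → Fin 2 → ℂ)
    (h100 : ψ 1 0 0 = (a : ℂ)) (h010 : ψ 0 1 0 = (b : ℂ))
    (h001 : ψ 0 0 1 = (c : ℂ)) (h111 : ψ 1 1 1 = (d : ℂ))
    (hzero : ∀ i j k : Fin 2, ¬(i = 1 ∧ j = 0 ∧ k = 0) → ¬(i = 0 ∧ j = 1 ∧ k = 0) →
      ¬(i = 0 ∧ j = 0 ∧ k = 1) → ¬(i = 1 ∧ j = 1 ∧ k = 1) → ψ i j k = 0) :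
    (Lmax ψ) ^ 2 = l ^ 2 := by
  have hsingle (i : Fin 2) : ∑ j : Fin 2, ‖(Pi.single i 1 : Fin 2 → ℂ) j‖ ^ 2 = 1 := by
    fin_cases i <;> simp
  have hbasis : ∃ i j k, ‖ψ i j k‖ = l := by
    rcases max_choice (max a b) (max c d) with h | h <;> rw [h] at hl
    · rcases max_choice a b with h | h <;> rw [h] at hl
      · exact ⟨1, 0, 0, by simp [h100, hl, ha.le]⟩
      · exact ⟨0, 1, 0, by simp [h010, hl, hb.le]⟩
    · rcases max_choice c d with h | h <;> rw [h] at hl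
      · exact ⟨0, 0, 1, by simp [h001, hl, hc.le]⟩
      · exact ⟨1, 1, 1, by simp [h111, hl, hd.le]⟩
  have hgreatest : IsGreatest {r : ℝ | ∃ u v w : Fin 2 → ℂ,
      (∑ i : Fin 2, ‖u i‖ ^ 2) = 1 ∧ (∑ i : Fin 2, ‖v i‖ ^ 2) = 1 ∧
        (∑ i : Fin 2, ‖w i‖ ^ 2) = 1 ∧ r = prodOverlap ψ u v w} l := by
    constructor
    · obtain ⟨i, j, k, h⟩ := hbasis
      exact ⟨_, _, _, hsingle i, hsingle j, hsingle k, by rw [prodOverlap_single, h]⟩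
    · rintro r ⟨u, v, w, hu, hv, hw, rfl⟩
      rw [Fin.sum_univ_two] at hu hv hw
      have hle : prodOverlap ψ u v w ≤
          a * (‖u 1‖ * ‖v 0‖ * ‖w 0‖) + b * (‖u 0‖ * ‖v 1‖ * ‖w 0‖) +
            c * (‖u 0‖ * ‖v 0‖ * ‖w 1‖) + d * (‖u 1‖ * ‖v 1‖ * ‖w 1‖) := by
        have h000 : ψ 0 0 0 = 0 := hzero 0 0 0 (by simp) (by simp) (by simp) (by simp)
        have h011 : ψ 0 1 1 = 0 := hzero 0 1 1 (by simp) (by simp) (by simp) (by simp)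
        have h101 : ψ 1 0 1 = 0 := hzero 1 0 1 (by simp) (by simp) (by simp) (by simp)
        have h110 : ψ 1 1 0 = 0 := hzero 1 1 0 (by simp) (by simp) (by simp) (by simp)
        simp only [prodOverlap, Fin.sum_univ_two, h000, h001, h010, h011, h100, h101, h110, h111,
          mul_zero, add_zero, zero_add]
        refine (norm_add_le _ _).trans ((add_le_add (norm_add_le _ _) (norm_add_le _ _)).trans ?_)
        simp only [norm_mul, RCLike.norm_conj, Complex.norm_real, Real.norm_eq_abs, abs_of_pos ha,
          abs_of_pos hb, abs_of_pos hc, abs_of_pos hd]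
        apply le_of_eq
        ring
      refine hle.trans ?_
      have hal : a ≤ l := by simp [hl]
      have hbl : b ≤ l := by simp [hl]
      have hcl : c ≤ l := by simp [hl]
      have hdl : d ≤ l := by simp [hl]
      have hu' := (add_comm _ _).trans hu
      have hv' := (add_comm _ _).trans hv
      have hw' := (add_comm _ _).trans hw
      -- Flipping two of the qubits permutes the coefficients, so each may be taken as the largest.
      rcases max_choice (max a b) (max c d) with h | h <;> rw [h] at hl
      · rcases max_choice a b with h | h <;> rw [h] at hl <;> subst hl
        · linarith [trilinear_le_of_largest_coefficient hd hc hb ha (by linarith) hdl hcl hbl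
            (by linarith) hu hv' hw']
        · linarith [trilinear_le_of_largest_coefficient hc hd ha hb (by linarith) hcl hdl hal
            (by linarith) hu' hv hw']
      · rcases max_choice c d with h | h <;> rw [h] at hl <;> subst hl
        · linarith [trilinear_le_of_largest_coefficient hb ha hd hc (by linarith) hbl hal hdl
            (by linarith) hu' hv' hw]
        · exact trilinear_le_of_largest_coefficient ha hb hc hd hnorm hal hbl hcl hcond hu hv hw
  rw [Lmax, hgreatest.csSup_eq]
end

section
/- Let n ≥ 1 and let c : Fin n → ℝ satisfy c k ≥ 0 for all k and ∑_k (c k)² = 1. If some index j satisfies (c j)² ≥ 1/2 (so c j is the largest coefficient and the W state is slightly entangled), then Λmax(W_c) = c j, and the supremum is attained by the product state u with u j = |1⟩ and u k = |0⟩ for k ≠ j. -/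
open scoped BigOperators

/-- The product overlap of an `n`-qubit state `ψ` with a family `u` of single-qubit vectors. -/
noncomputable def prodOverlapN (n : ℕ) (ψ : (Fin n → Fin 2) → ℂ) (u : Fin n → Fin 2 → ℂ) : ℝ :=
  ‖∑ x : Fin n → Fin 2, (∏ k : Fin n, (starRingEnd ℂ) (u k (x k))) * ψ x‖

/-- The maximal product overlap `Λmax` of an `n`-qubit state: the supremum of the
product overlap over all families of unit vectors. -/
noncomputable def LmaxN (n : ℕ) (ψ : (Fin n → Fin 2) → ℂ) : ℝ :=
  sSup {r : ℝ | ∃ u : Fin n → Fin 2 → ℂ,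
    (∀ k : Fin n, (∑ i : Fin 2, ‖u k i‖ ^ 2) = 1) ∧ r = prodOverlapN n ψ u}

/-- The `n`-qubit W state with coefficients `c`: the component on the basis tuple having a
single `1` at position `k` (and `0` elsewhere) is `c k`, and all other components vanish. -/
noncomputable def Wstate (n : ℕ) (c : Fin n → ℝ) : (Fin n → Fin 2) → ℂ :=
  fun x => ∑ k : Fin n, if x k = 1 ∧ ∀ j : Fin n, j ≠ k → x j = 0 then (c k : ℂ) else 0

/-- The amplitude of a generalized W state against a product state, written as a sum over the
position of the single `1`. -/
theorem sum_prod_mul_Wstate (n : ℕ) (c : Fin n → ℝ) (v : Fin n → Fin 2 → ℂ) :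
    ∑ x : Fin n → Fin 2, (∏ k, v k (x k)) * Wstate n c x =
      ∑ k, (c k : ℂ) * (v k 1 * ∏ l ∈ Finset.univ.erase k, v l 0) := by
  have single_iff (k : Fin n) (x : Fin n → Fin 2) :
      (x k = 1 ∧ ∀ i : Fin n, i ≠ k → x i = 0) ↔ x = Pi.single k 1 := by
    constructor
    · rintro ⟨h1, h0⟩
      ext i
      by_cases hi : i = k
      · subst hi; simp [h1]
      · simp [h0 i hi, hi]
    · rintro rfl
      exact ⟨by simp, fun i hi => by simp [hi]⟩
  simp only [Wstate, single_iff, Finset.mul_sum]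
  rw [Finset.sum_comm]
  refine Finset.sum_congr rfl fun k _ => ?_
  simp only [mul_ite, mul_zero, Finset.sum_ite_eq', Finset.mem_univ, if_true]
  rw [← Finset.mul_prod_erase Finset.univ _ (Finset.mem_univ k), mul_comm]
  congr 2
  · simp
  · refine Finset.prod_congr rfl fun l hl => ?_
    simp [Finset.ne_of_mem_erase hl]

/-- The terms of degree at most one in `y` of the expansion of `∏ (x + y)` are bounded by the
whole product. -/
theorem prod_add_sum_mul_prod_erase_le {ι : Type*} [DecidableEq ι] (s : Finset ι) (x y : ι → ℝ)
    (hx : ∀ i, 0 ≤ x i) (hy : ∀ i, 0 ≤ y i) :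
    ∏ i ∈ s, x i + ∑ k ∈ s, y k * ∏ l ∈ s.erase k, x l ≤ ∏ i ∈ s, (x i + y i) := by
  induction s using Finset.induction_on with
  | empty => simp
  | insert a s ha ih =>
    have hsum : ∑ k ∈ s, y k * ∏ l ∈ (insert a s).erase k, x l =
        x a * ∑ k ∈ s, y k * ∏ l ∈ s.erase k, x l := by
      rw [Finset.mul_sum]
      refine Finset.sum_congr rfl fun k hk => ?_
      have hak : a ≠ k := fun h => ha (h ▸ hk)
      rw [Finset.erase_insert_of_ne hak, Finset.prod_insert (by simp [ha])]
      ring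
    rw [Finset.prod_insert ha, Finset.prod_insert ha, Finset.sum_insert ha, hsum,
      Finset.erase_insert ha]
    have hQ : 0 ≤ ∑ k ∈ s, y k * ∏ l ∈ s.erase k, x l :=
      Finset.sum_nonneg fun k _ => mul_nonneg (hy k) (Finset.prod_nonneg fun l _ => hx l)
    nlinarith [mul_le_mul_of_nonneg_left ih (add_nonneg (hx a) (hy a)), mul_nonneg (hy a) hQ]

/-- If the coefficient `c j` dominates the others in the Euclidean sense, then it bounds the
real amplitude of the W state against every product of unit vectors. -/
theorem sum_mul_prod_erase_le {ι : Type*} [Fintype ι] [DecidableEq ι] (c a b : ι → ℝ) (j : ι)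
    (hcj : 0 ≤ c j) (hdom : ∑ k ∈ Finset.univ.erase j, c k ^ 2 ≤ c j ^ 2)
    (hab : ∀ k, a k ^ 2 + b k ^ 2 = 1) :
    ∑ k, c k * (b k * ∏ l ∈ Finset.univ.erase k, a l) ≤ c j := by
  set s : Finset ι := Finset.univ.erase j with hs
  set P := ∏ l ∈ s, a l with hP
  set S := ∑ k ∈ s, c k * (b k * ∏ l ∈ s.erase k, a l) with hS
  have split : ∑ k, c k * (b k * ∏ l ∈ Finset.univ.erase k, a l) =
      b j * (c j * P) + a j * S := by
    rw [← Finset.add_sum_erase _ _ (Finset.mem_univ j), ← hs, hS, Finset.mul_sum]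
    congr 1
    · ring
    · refine Finset.sum_congr rfl fun k hk => ?_
      have hjk : j ∈ Finset.univ.erase k :=
        Finset.mem_erase.2 ⟨(Finset.ne_of_mem_erase hk).symm, Finset.mem_univ j⟩
      rw [← Finset.mul_prod_erase _ _ hjk, Finset.erase_right_comm]
      ring
  set Q := ∑ k ∈ s, (b k * ∏ l ∈ s.erase k, a l) ^ 2 with hQ
  have hQ0 : 0 ≤ Q := Finset.sum_nonneg fun _ _ => sq_nonneg _
  have hSQ : S ^ 2 ≤ c j ^ 2 * Q :=
    (Finset.sum_mul_sq_le_sq_mul_sq s c _).trans (mul_le_mul_of_nonneg_right hdom hQ0)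
  have hPQ : P ^ 2 + Q ≤ 1 := by
    have h := prod_add_sum_mul_prod_erase_le s (fun i => a i ^ 2) (fun i => b i ^ 2)
      (fun i => sq_nonneg _) (fun i => sq_nonneg _)
    simpa only [hab, Finset.prod_const_one, Finset.prod_pow, ← mul_pow] using h
  rw [split]
  refine le_of_sq_le_sq ?_ hcj
  have hcs : (b j * (c j * P) + a j * S) ^ 2 ≤ (c j * P) ^ 2 + S ^ 2 := by
    have h1 : (c j * P) ^ 2 + S ^ 2 = (a j ^ 2 + b j ^ 2) * ((c j * P) ^ 2 + S ^ 2) := by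
      rw [hab, one_mul]
    rw [h1]
    nlinarith [sq_nonneg (a j * (c j * P) - b j * S)]
  nlinarith [mul_le_mul_of_nonneg_left hPQ (sq_nonneg (c j))]

/-- The maximal product overlap is attained at `u` if `u` bounds all product overlaps. -/
theorem LmaxN_eq_of_forall_le {n : ℕ} {ψ : (Fin n → Fin 2) → ℂ} {u : Fin n → Fin 2 → ℂ}
    (hu : ∀ k, ∑ i, ‖u k i‖ ^ 2 = 1)
    (hle : ∀ v : Fin n → Fin 2 → ℂ, (∀ k, ∑ i, ‖v k i‖ ^ 2 = 1) →
      prodOverlapN n ψ v ≤ prodOverlapN n ψ u) :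
    LmaxN n ψ = prodOverlapN n ψ u := by
  refine IsGreatest.csSup_eq ⟨⟨u, hu, rfl⟩, ?_⟩
  rintro r ⟨v, hv, rfl⟩
  exact hle v hv

theorem Lmax_W_state_slightly_entangled (n : ℕ) (hn : 1 ≤ n) (c : Fin n → ℝ)
    (hc : ∀ k, 0 ≤ c k) (hnorm : (∑ k : Fin n, (c k) ^ 2) = 1)
    (j : Fin n) (hj : 1 / 2 ≤ (c j) ^ 2)
    (u : Fin n → Fin 2 → ℂ)
    (hu : u = fun k => if k = j then (fun i : Fin 2 => if i = 1 then 1 else 0)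
      else (fun i : Fin 2 => if i = 0 then 1 else 0)) :
    LmaxN n (Wstate n c) = c j ∧ prodOverlapN n (Wstate n c) u = LmaxN n (Wstate n c) := by
  have hunit : ∀ k, ∑ i, ‖u k i‖ ^ 2 = 1 := by
    intro k
    by_cases hk : k = j <;> simp [hu, hk]
  have hoverlap : prodOverlapN n (Wstate n c) u = c j := by
    unfold prodOverlapN
    rw [sum_prod_mul_Wstate n c fun k i => (starRingEnd ℂ) (u k i),
      Finset.sum_eq_single_of_mem j (Finset.mem_univ j) fun k _ hk => by simp [hu, hk],
      Finset.prod_eq_one fun l hl => by simp [hu, Finset.ne_of_mem_erase hl]]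
    simp [hu, abs_of_nonneg (hc j)]
  have hmax : LmaxN n (Wstate n c) = prodOverlapN n (Wstate n c) u := by
    refine LmaxN_eq_of_forall_le hunit fun v hv => ?_
    rw [hoverlap]
    unfold prodOverlapN
    rw [sum_prod_mul_Wstate n c fun k i => (starRingEnd ℂ) (v k i)]
    refine (norm_sum_le _ _).trans ?_
    simp only [norm_mul, norm_prod, RCLike.norm_conj, Complex.norm_real, Real.norm_eq_abs,
      abs_of_nonneg (hc _)]
    refine sum_mul_prod_erase_le c (fun k => ‖v k 0‖) (fun k => ‖v k 1‖) j (hc j) ?_ fun k => ?_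
    · rw [← Finset.add_sum_erase _ _ (Finset.mem_univ j)] at hnorm
      linarith
    · simpa [Fin.sum_univ_two] using hv k
  exact ⟨hmax.trans hoverlap, hmax.symm⟩
end

section
/- Let n ≥ 1 and let c : Fin n → ℝ satisfy c k > 0 for all k and ∑_k (c k)² = 1. If u : Fin n → (Fin 2 → ℂ) is a family of unit vectors whose product overlap with the W state W_c equals Λmax(W_c) (i.e. u attains the supremum), then ∑_k ‖u k 1‖² = 1, where u k 1 denotes the component of u k on the basis vector |1⟩. (The squared moduli of the |1⟩-components of the nearest product state's factors are direction cosines of a unit vector in ℝⁿ.) -/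
open scoped BigOperators

/-- The complex amplitude whose norm is the product overlap. -/
noncomputable def prodAmplitude (n : ℕ) (ψ : (Fin n → Fin 2) → ℂ) (u : Fin n → Fin 2 → ℂ) : ℂ :=
  ∑ x : Fin n → Fin 2, (∏ k : Fin n, (starRingEnd ℂ) (u k (x k))) * ψ x

theorem prodOverlapN_eq_norm (n : ℕ) (ψ : (Fin n → Fin 2) → ℂ) (u : Fin n → Fin 2 → ℂ) :
    prodOverlapN n ψ u = ‖prodAmplitude n ψ u‖ := rfl

/-- The amplitude is conjugate-linear in each single-qubit vector. -/
theorem prodAmplitude_update (n : ℕ) (ψ : (Fin n → Fin 2) → ℂ) (u : Fin n → Fin 2 → ℂ)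
    (k : Fin n) (v : Fin 2 → ℂ) :
    prodAmplitude n ψ (Function.update u k v) =
      (starRingEnd ℂ) (v 0) * prodAmplitude n ψ (Function.update u k ![1, 0]) +
      (starRingEnd ℂ) (v 1) * prodAmplitude n ψ (Function.update u k ![0, 1]) := by
  have hprod (w : Fin 2 → ℂ) (x : Fin n → Fin 2) :
      ∏ j, (starRingEnd ℂ) (Function.update u k w j (x j)) =
        (starRingEnd ℂ) (w (x k)) * ∏ j ∈ Finset.univ.erase k, (starRingEnd ℂ) (u j (x j)) := by
    rw [← Finset.mul_prod_erase _ _ (Finset.mem_univ k), Function.update_self]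
    congr 1
    refine Finset.prod_congr rfl fun j hj => ?_
    rw [Function.update_of_ne (Finset.ne_of_mem_erase hj)]
  simp only [prodAmplitude, hprod, Finset.mul_sum, ← Finset.sum_add_distrib]
  refine Finset.sum_congr rfl fun x _ => ?_
  obtain h | h : x k = 0 ∨ x k = 1 := by omega
  all_goals simp [h, mul_assoc]

theorem prodAmplitude_Wstate (n : ℕ) (c : Fin n → ℝ) (u : Fin n → Fin 2 → ℂ) :
    prodAmplitude n (Wstate n c) u =
      ∑ k, (starRingEnd ℂ) (u k 1) *
        ((c k : ℂ) * ∏ j ∈ Finset.univ.erase k, (starRingEnd ℂ) (u j 0)) := by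
  simp only [prodAmplitude, Wstate, Finset.mul_sum]
  rw [Finset.sum_comm]
  refine Finset.sum_congr rfl fun k _ => ?_
  rw [Finset.sum_eq_single (Pi.single k 1)]
  · rw [← Finset.mul_prod_erase _ _ (Finset.mem_univ k), if_pos
      ⟨Pi.single_eq_same k 1, fun j hj => Pi.single_eq_of_ne hj 1⟩, Pi.single_eq_same,
      Finset.prod_congr rfl fun j hj => by rw [Pi.single_eq_of_ne (Finset.ne_of_mem_erase hj)]]
    ring
  · intro x _ hx
    rw [if_neg, mul_zero]
    rintro ⟨h1, h0⟩
    refine hx (funext fun j => ?_)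
    obtain rfl | hj := eq_or_ne j k
    · simp [h1]
    · simp [h0 j hj, hj]
  · simp

theorem prodAmplitude_Wstate_update_one (n : ℕ) (c : Fin n → ℝ) (u : Fin n → Fin 2 → ℂ)
    (k : Fin n) :
    prodAmplitude n (Wstate n c) (Function.update u k ![0, 1]) =
      (c k : ℂ) * ∏ j ∈ Finset.univ.erase k, (starRingEnd ℂ) (u j 0) := by
  rw [prodAmplitude_Wstate, Finset.sum_eq_single k]
  · rw [Finset.prod_congr rfl fun j hj => by
      rw [Function.update_of_ne (Finset.ne_of_mem_erase hj)]]
    simp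
  · intro i _ hi
    rw [Finset.prod_eq_zero (i := k) (by simp [hi.symm]) (by simp)]
    simp
  · simp

theorem prodOverlapN_le_LmaxN (n : ℕ) (ψ : (Fin n → Fin 2) → ℂ) (u : Fin n → Fin 2 → ℂ)
    (hu : ∀ k, (∑ i, ‖u k i‖ ^ 2) = 1) : prodOverlapN n ψ u ≤ LmaxN n ψ := by
  refine le_csSup ⟨∑ x, ‖ψ x‖, ?_⟩ ⟨u, hu, rfl⟩
  rintro _ ⟨v, hv, rfl⟩
  refine (norm_sum_le _ _).trans (Finset.sum_le_sum fun x _ => ?_)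
  rw [norm_mul, norm_prod]
  refine mul_le_of_le_one_left (norm_nonneg _)
    (Finset.prod_le_one (fun _ _ => norm_nonneg _) fun k _ => ?_)
  rw [RCLike.norm_conj, ← sq_le_one_iff₀ (norm_nonneg _), ← hv k]
  exact Finset.single_le_sum (f := fun i => ‖v k i‖ ^ 2) (fun _ _ => sq_nonneg _)
    (Finset.mem_univ (x k))

/-- If the unit vector `v` maximizes `‖conj (v 0) * a + conj (v 1) * b‖` among unit vectors,
then `(a, b)` is a multiple of `v`. -/
theorem eq_mul_of_norm_conj_pairing_max (a b : ℂ) (v : Fin 2 → ℂ) (hv : ∑ i, ‖v i‖ ^ 2 = 1)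
    (hmax : ∀ w : Fin 2 → ℂ, ∑ i, ‖w i‖ ^ 2 = 1 →
      ‖(starRingEnd ℂ) (w 0) * a + (starRingEnd ℂ) (w 1) * b‖ ≤
        ‖(starRingEnd ℂ) (v 0) * a + (starRingEnd ℂ) (v 1) * b‖) :
    b = ((starRingEnd ℂ) (v 0) * a + (starRingEnd ℂ) (v 1) * b) * v 1 := by
  set z := (starRingEnd ℂ) (v 0) * a + (starRingEnd ℂ) (v 1) * b with hz
  have hle : ‖a‖ ^ 2 + ‖b‖ ^ 2 ≤ ‖z‖ ^ 2 := by
    obtain h0 | hpos := (by positivity : 0 ≤ ‖a‖ ^ 2 + ‖b‖ ^ 2).eq_or_lt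
    · rw [← h0]; positivity
    set r := √(‖a‖ ^ 2 + ‖b‖ ^ 2) with hr
    have hr0 : 0 < r := Real.sqrt_pos.2 hpos
    have hr2 : r ^ 2 = ‖a‖ ^ 2 + ‖b‖ ^ 2 := Real.sq_sqrt hpos.le
    have hrC : (r : ℂ) ≠ 0 := by exact_mod_cast hr0.ne'
    have h := hmax ![a / r, b / r] (by
      simp only [Fin.sum_univ_two, Matrix.cons_val_zero, Matrix.cons_val_one, norm_div,
        Complex.norm_real, Real.norm_eq_abs, div_pow, sq_abs, ← add_div, ← hr2]
      exact div_self (by positivity))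
    have hval : (starRingEnd ℂ) (![a / r, b / r] 0) * a +
        (starRingEnd ℂ) (![a / r, b / r] 1) * b = (r : ℂ) := by
      have ha := Complex.conj_mul' a
      have hb := Complex.conj_mul' b
      have hr2C : (r : ℂ) ^ 2 = (‖a‖ : ℂ) ^ 2 + (‖b‖ : ℂ) ^ 2 := by exact_mod_cast hr2
      simp only [Matrix.cons_val_zero, Matrix.cons_val_one, map_div₀, Complex.conj_ofReal]
      field_simp
      rw [ha, hb, hr2C]
    rw [hval, Complex.norm_real, Real.norm_of_nonneg hr0.le] at h
    rw [← hr2]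
    gcongr
  have hsum : ‖a - z * v 0‖ ^ 2 + ‖b - z * v 1‖ ^ 2 = ‖a‖ ^ 2 + ‖b‖ ^ 2 - ‖z‖ ^ 2 := by
    have hzc : (starRingEnd ℂ) z =
        v 0 * (starRingEnd ℂ) a + v 1 * (starRingEnd ℂ) b := by simp [hz]
    have hvC : (starRingEnd ℂ) (v 0) * v 0 + (starRingEnd ℂ) (v 1) * v 1 = 1 := by
      rw [Complex.conj_mul', Complex.conj_mul']
      rw [Fin.sum_univ_two] at hv
      exact_mod_cast hv
    apply Complex.ofReal_injective
    push_cast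
    simp only [← Complex.conj_mul', map_sub, map_mul]
    linear_combination (starRingEnd ℂ) z * hz + z * hzc + z * (starRingEnd ℂ) z * hvC
  have hb : ‖b - z * v 1‖ ^ 2 = 0 := by
    nlinarith [sq_nonneg ‖a - z * v 0‖, sq_nonneg ‖b - z * v 1‖]
  exact sub_eq_zero.1 (norm_eq_zero.1 (pow_eq_zero_iff two_ne_zero |>.1 hb))

theorem LmaxN_Wstate_pos (n : ℕ) (c : Fin n → ℝ) (k : Fin n) (hk : 0 < c k) :
    0 < LmaxN n (Wstate n c) := by
  refine lt_of_lt_of_le ?_ (prodOverlapN_le_LmaxN n (Wstate n c)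
    (Function.update (fun _ => ![1, 0]) k ![0, 1]) fun j => ?_)
  · rw [prodOverlapN_eq_norm, prodAmplitude_Wstate_update_one]
    simpa using hk.ne'
  · obtain rfl | hj := eq_or_ne j k
    · simp
    · simp [hj]

theorem W_state_nearest_product_direction_cosines (n : ℕ) (hn : 1 ≤ n) (c : Fin n → ℝ)
    (hc : ∀ k, 0 < c k) (hnorm : (∑ k : Fin n, (c k) ^ 2) = 1)
    (u : Fin n → Fin 2 → ℂ)
    (hu : ∀ k : Fin n, (∑ i : Fin 2, ‖u k i‖ ^ 2) = 1)
    (hmax : prodOverlapN n (Wstate n c) u = LmaxN n (Wstate n c)) :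
    (∑ k : Fin n, ‖u k 1‖ ^ 2) = 1 := by
  set z := prodAmplitude n (Wstate n c) u with hz
  have hz0 : z ≠ 0 := by
    rw [← norm_pos_iff, hz, ← prodOverlapN_eq_norm, hmax]
    exact LmaxN_Wstate_pos n c ⟨0, hn⟩ (hc _)
  have hstat (k : Fin n) :
      (c k : ℂ) * ∏ j ∈ Finset.univ.erase k, (starRingEnd ℂ) (u j 0) = z * u k 1 := by
    have hzk := prodAmplitude_update n (Wstate n c) u k (u k)
    rw [Function.update_eq_self, ← hz] at hzk
    rw [← prodAmplitude_Wstate_update_one, hzk]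
    refine eq_mul_of_norm_conj_pairing_max _ _ (u k) (hu k) fun w hw => ?_
    rw [← hzk, ← prodAmplitude_update, hz, ← prodOverlapN_eq_norm, ← prodOverlapN_eq_norm, hmax]
    refine prodOverlapN_le_LmaxN n _ _ fun j => ?_
    obtain rfl | hj := eq_or_ne j k
    · simpa using hw
    · simpa [hj] using hu j
  have hsum : z * ∑ k, ((‖u k 1‖ : ℂ) ^ 2) = z * 1 := by
    rw [mul_one, Finset.mul_sum]
    conv_rhs => rw [hz, prodAmplitude_Wstate]
    refine Finset.sum_congr rfl fun k _ => ?_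
    rw [hstat, ← Complex.conj_mul']
    ring
  exact_mod_cast mul_left_cancel₀ hz0 hsum
end

section
/- Let a, b, c be positive reals with r_a := b² + c² − a² ≥ 0, r_b := a² + c² − b² ≥ 0, r_c := a² + b² − c² ≥ 0 (a non-obtuse triangle), and let S > 0 be defined by 16·S² = (a+b+c)·(−a+b+c)·(a−b+c)·(a+b−c). Let ψ be the three-qubit state with ψ 1 0 0 = a, ψ 0 1 0 = b, ψ 0 0 1 = c and all other components 0, and define real vectors u₁ = (a·√(2·r_a), √(r_b·r_c))/(4S), u₂ = (b·√(2·r_b), √(r_a·r_c))/(4S), u₃ = (c·√(2·r_c), √(r_a·r_b))/(4S) (components indexed by Fin 2, first component at 0). Then u₁, u₂, u₃ are unit vectors and, with Λ = a·b·c/(2·S), they satisfy the stationarity (nonlinear eigenvalue) equations: for every i, ∑_{j,k} u₂ j · u₃ k · ψ i j k = Λ · u₁ i; for every j, ∑_{i,k} u₁ i · u₃ k · ψ i j k = Λ · u₂ j; and for every k, ∑_{i,j} u₁ i · u₂ j · ψ i j k = Λ · u₃ k. -/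
open scoped BigOperators

theorem W_type_stationarity_solution (a b c S : ℝ)
    (ha : 0 < a) (hb : 0 < b) (hc : 0 < c)
    (hra : 0 ≤ b ^ 2 + c ^ 2 - a ^ 2) (hrb : 0 ≤ a ^ 2 + c ^ 2 - b ^ 2)
    (hrc : 0 ≤ a ^ 2 + b ^ 2 - c ^ 2)
    (hS : 0 < S) (hSdef : 16 * S ^ 2 = (a + b + c) * (-a + b + c) * (a - b + c) * (a + b - c))
    (ψ : Fin 2 → Fin 2 → Fin 2 → ℂ)
    (h100 : ψ 1 0 0 = (a : ℂ)) (h010 : ψ 0 1 0 = (b : ℂ)) (h001 : ψ 0 0 1 = (c : ℂ))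
    (hzero : ∀ i j k : Fin 2, ¬(i = 1 ∧ j = 0 ∧ k = 0) → ¬(i = 0 ∧ j = 1 ∧ k = 0) →
      ¬(i = 0 ∧ j = 0 ∧ k = 1) → ψ i j k = 0)
    (u₁ u₂ u₃ : Fin 2 → ℂ)
    (hu₁ : u₁ = ![((a * Real.sqrt (2 * (b ^ 2 + c ^ 2 - a ^ 2)) / (4 * S) : ℝ) : ℂ),
      ((Real.sqrt ((a ^ 2 + c ^ 2 - b ^ 2) * (a ^ 2 + b ^ 2 - c ^ 2)) / (4 * S) : ℝ) : ℂ)])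
    (hu₂ : u₂ = ![((b * Real.sqrt (2 * (a ^ 2 + c ^ 2 - b ^ 2)) / (4 * S) : ℝ) : ℂ),
      ((Real.sqrt ((b ^ 2 + c ^ 2 - a ^ 2) * (a ^ 2 + b ^ 2 - c ^ 2)) / (4 * S) : ℝ) : ℂ)])
    (hu₃ : u₃ = ![((c * Real.sqrt (2 * (a ^ 2 + b ^ 2 - c ^ 2)) / (4 * S) : ℝ) : ℂ),
      ((Real.sqrt ((b ^ 2 + c ^ 2 - a ^ 2) * (a ^ 2 + c ^ 2 - b ^ 2)) / (4 * S) : ℝ) : ℂ)])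
    (Λ : ℝ) (hΛ : Λ = a * b * c / (2 * S)) :
    (∑ i : Fin 2, ‖u₁ i‖ ^ 2) = 1 ∧ (∑ i : Fin 2, ‖u₂ i‖ ^ 2) = 1 ∧
      (∑ i : Fin 2, ‖u₃ i‖ ^ 2) = 1 ∧
      (∀ i : Fin 2, (∑ j : Fin 2, ∑ k : Fin 2, u₂ j * u₃ k * ψ i j k) = (Λ : ℂ) * u₁ i) ∧
      (∀ j : Fin 2, (∑ i : Fin 2, ∑ k : Fin 2, u₁ i * u₃ k * ψ i j k) = (Λ : ℂ) * u₂ j) ∧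
      (∀ k : Fin 2, (∑ i : Fin 2, ∑ j : Fin 2, u₁ i * u₂ j * ψ i j k) = (Λ : ℂ) * u₃ k) := by
  have hS0 : (S : ℂ) ≠ 0 := by exact_mod_cast hS.ne'
  rw [Real.sqrt_mul (by norm_num), Real.sqrt_mul hrb] at hu₁
  rw [Real.sqrt_mul (by norm_num), Real.sqrt_mul hra] at hu₂
  rw [Real.sqrt_mul (by norm_num), Real.sqrt_mul hra] at hu₃
  have hp := Real.sq_sqrt (show (0 : ℝ) ≤ 2 by norm_num)
  have hx := Real.sq_sqrt hra
  have hy := Real.sq_sqrt hrb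
  have hz := Real.sq_sqrt hrc
  generalize √(b ^ 2 + c ^ 2 - a ^ 2) = x at hu₁ hu₂ hu₃ hx
  generalize √(a ^ 2 + c ^ 2 - b ^ 2) = y at hu₁ hu₂ hu₃ hy
  generalize √(a ^ 2 + b ^ 2 - c ^ 2) = z at hu₁ hu₂ hu₃ hz
  generalize √2 = p at hu₁ hu₂ hu₃ hp
  have hp' : (p : ℂ) ^ 2 = 2 := by exact_mod_cast hp
  have hx' : (x : ℂ) ^ 2 = b ^ 2 + c ^ 2 - a ^ 2 := by exact_mod_cast hx
  have hy' : (y : ℂ) ^ 2 = a ^ 2 + c ^ 2 - b ^ 2 := by exact_mod_cast hy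
  have hz' : (z : ℂ) ^ 2 = a ^ 2 + b ^ 2 - c ^ 2 := by exact_mod_cast hz
  have h000 : ψ 0 0 0 = 0 := hzero _ _ _ (by decide) (by decide) (by decide)
  have h011 : ψ 0 1 1 = 0 := hzero _ _ _ (by decide) (by decide) (by decide)
  have h101 : ψ 1 0 1 = 0 := hzero _ _ _ (by decide) (by decide) (by decide)
  have h110 : ψ 1 1 0 = 0 := hzero _ _ _ (by decide) (by decide) (by decide)
  have h111 : ψ 1 1 1 = 0 := hzero _ _ _ (by decide) (by decide) (by decide)
  subst hu₁ hu₂ hu₃ hΛ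
  simp only [Fin.forall_fin_two, Fin.sum_univ_two, Matrix.cons_val_zero, Matrix.cons_val_one,
    Complex.norm_real, Real.norm_eq_abs, sq_abs, h000, h001, h010, h011, h100, h101, h110, h111]
  push_cast
  refine ⟨?_, ?_, ?_, ⟨?_, ?_⟩, ⟨?_, ?_⟩, ⟨?_, ?_⟩⟩ <;> field_simp
  · linear_combination a ^ 2 * x ^ 2 * hp + 2 * a ^ 2 * hx + z ^ 2 * hy +
      (a ^ 2 + c ^ 2 - b ^ 2) * hz - hSdef
  · linear_combination b ^ 2 * y ^ 2 * hp + 2 * b ^ 2 * hy + z ^ 2 * hx +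
      (b ^ 2 + c ^ 2 - a ^ 2) * hz - hSdef
  · linear_combination c ^ 2 * z ^ 2 * hp + 2 * c ^ 2 * hz + y ^ 2 * hx +
      (b ^ 2 + c ^ 2 - a ^ 2) * hy - hSdef
  · linear_combination 2 * p * b * c * x * (hy' + hz')
  · linear_combination 2 * a * b * c * y * z * hp'
  · linear_combination 2 * p * a * c * y * (hx' + hz')
  · linear_combination 2 * a * b * c * x * z * hp'
  · linear_combination 2 * p * a * b * z * (hx' + hy')
  · linear_combination 2 * a * b * c * x * y * hp'
end

section
/- Let n ≥ 1 and let y : Fin n → ℝ satisfy 0 ≤ y i ≤ 1 for all i and ∑_i y i = n − 1. Then ∑_i y i ≥ ∑_i (y i)² + 2·∏_i y i. -/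
open scoped BigOperators

/-- The first two Bonferroni inequalities for `∏ (1 - z i)`, with the second elementary symmetric
sum written through power sums. -/
theorem prod_one_sub_bonferroni {ι : Type*} (s : Finset ι) (z : ι → ℝ)
    (h0 : ∀ i ∈ s, 0 ≤ z i) (h1 : ∀ i ∈ s, z i ≤ 1) :
    1 - ∑ i ∈ s, z i ≤ ∏ i ∈ s, (1 - z i) ∧
      2 * ∏ i ∈ s, (1 - z i) ≤
        2 - 2 * ∑ i ∈ s, z i + ((∑ i ∈ s, z i) ^ 2 - ∑ i ∈ s, z i ^ 2) := by
  classical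
  induction s using Finset.induction_on with
  | empty => simp
  | insert a s ha ih =>
    obtain ⟨hl, hu⟩ := ih (fun i hi => h0 i (Finset.mem_insert_of_mem hi))
      (fun i hi => h1 i (Finset.mem_insert_of_mem hi))
    have ha0 := h0 a (Finset.mem_insert_self a s)
    have hle : ∏ i ∈ s, (1 - z i) ≤ 1 := Finset.prod_le_one
      (fun i hi => sub_nonneg.2 (h1 i (Finset.mem_insert_of_mem hi)))
      (fun i hi => sub_le_self _ (h0 i (Finset.mem_insert_of_mem hi)))
    simp only [Finset.prod_insert ha, Finset.sum_insert ha]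
    constructor
    · nlinarith [mul_le_mul_of_nonneg_left hle ha0]
    · nlinarith [mul_le_mul_of_nonneg_left hl ha0]

theorem sum_ge_sum_sq_add_two_prod (n : ℕ) (hn : 1 ≤ n) (y : Fin n → ℝ)
    (h0 : ∀ i, 0 ≤ y i) (h1 : ∀ i, y i ≤ 1)
    (hsum : (∑ i : Fin n, y i) = (n : ℝ) - 1) :
    (∑ i : Fin n, y i) ≥ (∑ i : Fin n, (y i) ^ 2) + 2 * ∏ i : Fin n, y i := by
  have h := (prod_one_sub_bonferroni Finset.univ (fun i => 1 - y i)
    (fun i _ => sub_nonneg.2 (h1 i)) (fun i _ => sub_le_self _ (h0 i))).2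
  have hS : ∑ i, (1 - y i) = 1 := by simp [hsum]
  have hQ : ∑ i, (1 - y i) ^ 2 = n - 2 * ∑ i, y i + ∑ i, y i ^ 2 := by
    simp [sub_sq, Finset.sum_add_distrib, Finset.mul_sum]
  simp only [sub_sub_cancel, hS, hQ] at h
  linarith
end

section
/- Let m ≥ 2 and let c : Fin m → ℝ satisfy 0 ≤ c k for all k; let C = max over k of c k and assume C > 0. Then there exists a unique real r with r ≥ C such that ∑_k √(r² − (c k)²) = (m − 1)·r. -/
open scoped BigOperators

theorem sum_sqrt_sq_sub_sq_eq_mul_iff {m : ℕ} (c : Fin m → ℝ) (a : ℝ) {r : ℝ} (hr : 0 < r) :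
    ∑ k, Real.sqrt (r ^ 2 - c k ^ 2) = a * r ↔ ∑ k, Real.sqrt (1 - (r⁻¹ * c k) ^ 2) = a := by
  have key : ∀ k, Real.sqrt (r ^ 2 - c k ^ 2) = Real.sqrt (1 - (r⁻¹ * c k) ^ 2) * r := fun k => by
    rw [← Real.sqrt_mul_self hr.le, ← Real.sqrt_mul' _ (mul_self_nonneg r), Real.sqrt_mul_self hr.le]
    congr 1
    field_simp
  simp_rw [key, ← Finset.sum_mul]
  exact mul_left_inj' hr.ne'

theorem strictAntiOn_sum_sqrt_one_sub_mul_sq {m : ℕ} {c : Fin m → ℝ} (hc : ∀ k, 0 ≤ c k) {C : ℝ}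
    (hC : IsGreatest (Set.range c) C) (hCpos : 0 < C) :
    StrictAntiOn (fun t : ℝ => ∑ k, Real.sqrt (1 - (t * c k) ^ 2)) (Set.Icc 0 C⁻¹) := by
  rintro s ⟨hs, -⟩ t ⟨-, ht⟩ hst
  obtain ⟨k₀, hk₀⟩ := hC.1
  refine Finset.sum_lt_sum (fun k _ => ?_) ⟨k₀, Finset.mem_univ _, ?_⟩
  · have := hc k
    gcongr
  · rw [hk₀]
    have hlt : s * C < t * C := by gcongr
    have h1 : t * C ≤ 1 := (le_inv_mul_iff₀' hCpos).1 (by simpa using ht)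
    have h0 : 0 ≤ s * C := by positivity
    exact Real.sqrt_lt_sqrt (by nlinarith) (by nlinarith)

theorem first_critical_value_exists_unique (m : ℕ) (hm : 2 ≤ m) (c : Fin m → ℝ)
    (hc : ∀ k, 0 ≤ c k) (C : ℝ) (hC : IsGreatest (Set.range c) C) (hCpos : 0 < C) :
    ∃! r : ℝ, C ≤ r ∧
      (∑ k : Fin m, Real.sqrt (r ^ 2 - (c k) ^ 2)) = ((m : ℝ) - 1) * r := by
  have hanti := strictAntiOn_sum_sqrt_one_sub_mul_sq hc hC hCpos
  have hend : ∑ k, Real.sqrt (1 - (C⁻¹ * c k) ^ 2) ≤ (m : ℝ) - 1 := by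
    obtain ⟨k₀, hk₀⟩ := hC.1
    rw [← Finset.add_sum_erase _ _ (Finset.mem_univ k₀), hk₀, inv_mul_cancel₀ hCpos.ne']
    have hle : ∑ k ∈ Finset.univ.erase k₀, Real.sqrt (1 - (C⁻¹ * c k) ^ 2)
        ≤ ∑ k ∈ Finset.univ.erase k₀, (1 : ℝ) :=
      Finset.sum_le_sum fun k _ => Real.sqrt_le_one.2 (sub_le_self _ (sq_nonneg _))
    have hcard : ∑ k ∈ Finset.univ.erase k₀, (1 : ℝ) = (m : ℝ) - 1 := by
      simp [Finset.card_erase_of_mem, Nat.cast_sub (show 1 ≤ m by omega)]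
    simpa [hcard] using hle
  have hcont : ContinuousOn (fun t : ℝ => ∑ k, Real.sqrt (1 - (t * c k) ^ 2))
      (Set.Icc 0 C⁻¹) := by fun_prop
  obtain ⟨t, ht, hteq⟩ := intermediate_value_Icc' (inv_nonneg.2 hCpos.le) hcont
    (show (m : ℝ) - 1 ∈ Set.Icc _ _ from ⟨hend, by simp⟩)
  have htpos : 0 < t := ht.1.lt_of_ne (by rintro rfl; simp at hteq; linarith)
  refine ⟨t⁻¹, ⟨(le_inv_comm₀ htpos hCpos).1 ht.2, ?_⟩, ?_⟩
  · rw [sum_sqrt_sq_sub_sq_eq_mul_iff c _ (inv_pos.2 htpos), inv_inv]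
    exact hteq
  · rintro r ⟨hCr, hr⟩
    have hrpos := hCpos.trans_le hCr
    rw [sum_sqrt_sq_sub_sq_eq_mul_iff c _ hrpos] at hr
    have hrt : r⁻¹ = t := hanti.injOn ⟨by positivity, inv_anti₀ hCpos hCr⟩ ht (hr.trans hteq.symm)
    rw [← hrt, inv_inv]
end

section
/- Let m ≥ 2 and let c : Fin m → ℝ satisfy 0 ≤ c k for all k; let C = max over k of c k with C > 0. Let r₁ be the unique real with r₁ ≥ C and ∑_k √(r₁² − (c k)²) = (m − 1)·r₁, and let r₂ = √(∑_k (c k)²). Then r₁ ≤ r₂. -/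
open scoped BigOperators

theorem first_critical_le_second_critical (m : ℕ) (hm : 2 ≤ m) (c : Fin m → ℝ)
    (hc : ∀ k, 0 ≤ c k) (C : ℝ) (hC : IsGreatest (Set.range c) C) (hCpos : 0 < C)
    (r₁ : ℝ) (hr₁ : C ≤ r₁)
    (heq₁ : (∑ k : Fin m, Real.sqrt (r₁ ^ 2 - (c k) ^ 2)) = ((m : ℝ) - 1) * r₁)
    (r₂ : ℝ) (hr₂ : r₂ = Real.sqrt (∑ k : Fin m, (c k) ^ 2)) :
    r₁ ≤ r₂ := by
  have hr : 0 ≤ r₁ := hCpos.le.trans hr₁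
  have hle (k : Fin m) : r₁ * (r₁ - √(r₁ ^ 2 - c k ^ 2)) ≤ c k ^ 2 := by
    have hck : c k ≤ r₁ := (hC.2 ⟨k, rfl⟩).trans hr₁
    have hnonneg : 0 ≤ r₁ ^ 2 - c k ^ 2 := sub_nonneg.2 (pow_le_pow_left₀ (hc k) hck 2)
    have hsqrt : √(r₁ ^ 2 - c k ^ 2) ≤ r₁ :=
      Real.sqrt_le_iff.2 ⟨hr, sub_le_self _ (sq_nonneg _)⟩
    nlinarith [Real.sq_sqrt hnonneg, Real.sqrt_nonneg (r₁ ^ 2 - c k ^ 2)]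
  have hsum : ∑ k, r₁ * (r₁ - √(r₁ ^ 2 - c k ^ 2)) = r₁ ^ 2 := by
    rw [← Finset.mul_sum, Finset.sum_sub_distrib, heq₁]
    simp only [Finset.sum_const, Finset.card_univ, Fintype.card_fin, nsmul_eq_mul]
    ring
  rw [hr₂]
  exact Real.le_sqrt_of_sq_le (hsum ▸ Finset.sum_le_sum fun k _ => hle k)
end

section
/- Let m ≥ 2 and let c : Fin m → ℝ satisfy 0 ≤ c k for all k; let C = max over k of c k with C > 0, and let d be a real with d ≥ C. Let r₁ be the unique real with r₁ ≥ C and ∑_k √(r₁² − (c k)²) = (m − 1)·r₁. Then the equation ∑_k √(r² − (c k)²) + √(r² − d²) = (m − 1)·r has a solution r with r ≥ d if and only if d ≤ r₁; moreover, when d ≤ r₁ this solution is unique. -/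
open scoped BigOperators

theorem sqrt_sq_sub_sq_eq_mul {r : ℝ} (hr : 0 < r) (a : ℝ) :
    Real.sqrt (r ^ 2 - a ^ 2) = r * Real.sqrt (1 - (a / r) ^ 2) := by
  have h : r ^ 2 - a ^ 2 = r ^ 2 * (1 - (a / r) ^ 2) := by field_simp
  rw [h, Real.sqrt_mul (sq_nonneg r), Real.sqrt_sq hr.le]

theorem monotoneOn_sqrt_one_sub_div_sq {a : ℝ} (ha : 0 ≤ a) :
    MonotoneOn (fun r : ℝ => Real.sqrt (1 - (a / r) ^ 2)) (Set.Ioi 0) := by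
  intro r hr s _ hrs
  have hr : 0 < r := hr
  have hs : 0 < s := hr.trans_le hrs
  dsimp only
  gcongr

theorem strictMonoOn_sqrt_one_sub_div_sq {a : ℝ} (ha : 0 < a) :
    StrictMonoOn (fun r : ℝ => Real.sqrt (1 - (a / r) ^ 2)) (Set.Ici a) := by
  intro r hr s _ hrs
  have hr : a ≤ r := hr
  have hr0 : 0 < r := ha.trans_le hr
  have hs : 0 < s := hr0.trans hrs
  apply Real.sqrt_lt_sqrt
  · have h1 : a / r ≤ 1 := (div_le_one hr0).2 hr
    have h0 : 0 ≤ a / r := by positivity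
    nlinarith
  · gcongr

theorem strictMonoOn_sum_sqrt_one_sub_div_sq {ι : Type*} [Fintype ι] {c : ι → ℝ}
    (hc : ∀ k, 0 ≤ c k) {j : ι} (hj : 0 < c j) :
    StrictMonoOn (fun r : ℝ => ∑ k, Real.sqrt (1 - (c k / r) ^ 2)) (Set.Ici (c j)) := by
  intro r hr s hs hrs
  refine Finset.sum_lt_sum (fun k _ => ?_) ⟨j, Finset.mem_univ j, ?_⟩
  · exact monotoneOn_sqrt_one_sub_div_sq (hc k) (hj.trans_le hr) (hj.trans_le hs) hrs.le
  · exact strictMonoOn_sqrt_one_sub_div_sq hj hr hs hrs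

theorem symmetric_stationarity_equation_solvability (m : ℕ) (hm : 2 ≤ m) (c : Fin m → ℝ)
    (hc : ∀ k, 0 ≤ c k) (C : ℝ) (hC : IsGreatest (Set.range c) C) (hCpos : 0 < C)
    (d : ℝ) (hd : C ≤ d)
    (r₁ : ℝ) (hr₁ : C ≤ r₁)
    (heq₁ : (∑ k : Fin m, Real.sqrt (r₁ ^ 2 - (c k) ^ 2)) = ((m : ℝ) - 1) * r₁) :
    ((∃ r : ℝ, d ≤ r ∧
        (∑ k : Fin m, Real.sqrt (r ^ 2 - (c k) ^ 2)) + Real.sqrt (r ^ 2 - d ^ 2)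
          = ((m : ℝ) - 1) * r) ↔ d ≤ r₁) ∧
      (d ≤ r₁ → ∃! r : ℝ, d ≤ r ∧
        (∑ k : Fin m, Real.sqrt (r ^ 2 - (c k) ^ 2)) + Real.sqrt (r ^ 2 - d ^ 2)
          = ((m : ℝ) - 1) * r) := by
  obtain ⟨⟨j, rfl⟩, -⟩ := hC
  set G : ℝ → ℝ := fun r => ∑ k, Real.sqrt (1 - (c k / r) ^ 2) with hG
  set F : ℝ → ℝ := fun r => G r + Real.sqrt (1 - (d / r) ^ 2) with hF
  have hd0 : 0 < d := hCpos.trans_le hd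
  have hsum (r : ℝ) (hr : 0 < r) :
      ∑ k : Fin m, Real.sqrt (r ^ 2 - (c k) ^ 2) = r * G r := by
    simp only [hG, Finset.mul_sum, sqrt_sq_sub_sq_eq_mul hr]
  have hG_mono : StrictMonoOn G (Set.Ici (c j)) :=
    strictMonoOn_sum_sqrt_one_sub_div_sq hc hCpos
  have hF_mono : StrictMonoOn F (Set.Ici d) := fun r hr s hs hrs =>
    add_lt_add (hG_mono (hd.trans hr) (hd.trans hs) hrs)
      (strictMonoOn_sqrt_one_sub_div_sq hd0 hr hs hrs)
  have hG₁ : G r₁ = (m : ℝ) - 1 := by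
    have hr₁0 : 0 < r₁ := hCpos.trans_le hr₁
    rw [hsum r₁ hr₁0, mul_comm] at heq₁
    exact mul_right_cancel₀ hr₁0.ne' heq₁
  have heq_iff (r : ℝ) (hr : d ≤ r) :
      (∑ k : Fin m, Real.sqrt (r ^ 2 - (c k) ^ 2)) + Real.sqrt (r ^ 2 - d ^ 2)
        = ((m : ℝ) - 1) * r ↔ F r = (m : ℝ) - 1 := by
    have hr0 : 0 < r := hd0.trans_le hr
    rw [hsum r hr0, sqrt_sq_sub_sq_eq_mul hr0, ← mul_add, mul_comm]
    exact mul_left_inj' hr0.ne'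
  have hexists (h : d ≤ r₁) : ∃ r, d ≤ r ∧ F r = (m : ℝ) - 1 := by
    have hcont : ContinuousOn F (Set.Icc d r₁) := by
      have hne : ∀ x ∈ Set.Icc d r₁, x ≠ 0 := fun x hx => (hd0.trans_le hx.1).ne'
      simp only [hF, hG]
      fun_prop (disch := assumption)
    have hFd : F d ≤ (m : ℝ) - 1 := by
      have : F d = G d := by simp [hF, hd0.ne']
      rw [this, ← hG₁]
      exact hG_mono.monotoneOn hd hr₁ h
    have hFr₁ : (m : ℝ) - 1 ≤ F r₁ := by
      rw [← hG₁]
      exact le_add_of_nonneg_right (Real.sqrt_nonneg _)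
    obtain ⟨r, hr, hFr⟩ := intermediate_value_Icc h hcont ⟨hFd, hFr₁⟩
    exact ⟨r, hr.1, hFr⟩
  refine ⟨⟨?_, fun h => ?_⟩, fun h => ?_⟩
  · rintro ⟨r, hr, heq⟩
    rw [heq_iff r hr, ← hG₁] at heq
    refine hr.trans ((hG_mono.le_iff_le (hd.trans hr) hr₁).1 ?_)
    rw [← heq]
    exact le_add_of_nonneg_right (Real.sqrt_nonneg _)
  · obtain ⟨r, hr, heq⟩ := hexists h
    exact ⟨r, hr, (heq_iff r hr).2 heq⟩
  · obtain ⟨r, hr, heq⟩ := hexists h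
    refine ⟨r, ⟨hr, (heq_iff r hr).2 heq⟩, fun s hs => ?_⟩
    exact hF_mono.injOn hs.1 hr (((heq_iff s hs.1).1 hs.2).trans heq.symm)
end

section
/- Let m ≥ 2 and let c : Fin m → ℝ satisfy 0 ≤ c k for all k; let C = max over k of c k with C > 0, and let d be a real with d ≥ C. Let r₁ be the unique real with r₁ ≥ C and ∑_k √(r₁² − (c k)²) = (m − 1)·r₁, and let r₂ = √(∑_k (c k)²). Then the 'asymmetric' equation ∑_k √(r² − (c k)²) − √(r² − d²) = (m − 1)·r has a unique solution r with r ≥ d whenever r₁ ≤ d < r₂, and it has no solution r ≥ d when d < r₁ or when d > r₂. -/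
/-- The gap between a hypotenuse `r` and the leg completing `a` to a right triangle. -/
noncomputable def legGap (a r : ℝ) : ℝ := r - √(r ^ 2 - a ^ 2)

lemma legGap_mul_add {a r : ℝ} (ha : 0 ≤ a) (har : a ≤ r) :
    legGap a r * (r + √(r ^ 2 - a ^ 2)) = a ^ 2 := by
  have h := Real.sq_sqrt (show 0 ≤ r ^ 2 - a ^ 2 by nlinarith)
  unfold legGap
  linear_combination -h

lemma legGap_eq_div {a r : ℝ} (ha : 0 ≤ a) (har : a ≤ r) (hr : 0 < r) :
    legGap a r = a ^ 2 / (r + √(r ^ 2 - a ^ 2)) := by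
  rw [eq_div_iff (by positivity), legGap_mul_add ha har]

lemma legGap_antitone {a r s : ℝ} (ha : 0 ≤ a) (har : a ≤ r) (hr : 0 < r) (hrs : r ≤ s) :
    legGap a s ≤ legGap a r := by
  rw [legGap_eq_div ha har hr, legGap_eq_div ha (har.trans hrs) (hr.trans_le hrs)]
  gcongr

lemma sq_div_two_mul_le_legGap {a r : ℝ} (ha : 0 ≤ a) (har : a ≤ r) (hr : 0 < r) :
    a ^ 2 / (2 * r) ≤ legGap a r := by
  rw [legGap_eq_div ha har hr]
  have : √(r ^ 2 - a ^ 2) ≤ r := Real.sqrt_le_iff.2 ⟨hr.le, by nlinarith [sq_nonneg a]⟩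
  gcongr
  linarith

/-- For `a < d`, the ratio `(r + √(r² - d²)) / (r + √(r² - a²))` is strictly increasing in `r`. -/
lemma add_sqrt_mul_add_sqrt_lt {a d r s : ℝ} (ha : 0 ≤ a) (had : a < d) (hdr : d ≤ r)
    (hrs : r < s) :
    (r + √(r ^ 2 - d ^ 2)) * (s + √(s ^ 2 - a ^ 2)) <
      (s + √(s ^ 2 - d ^ 2)) * (r + √(r ^ 2 - a ^ 2)) := by
  have hA := Real.sq_sqrt (show 0 ≤ r ^ 2 - d ^ 2 by nlinarith)
  have hA' := Real.sq_sqrt (show 0 ≤ s ^ 2 - d ^ 2 by nlinarith)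
  have hB := Real.sq_sqrt (show 0 ≤ r ^ 2 - a ^ 2 by nlinarith)
  have hB' := Real.sq_sqrt (show 0 ≤ s ^ 2 - a ^ 2 by nlinarith)
  have hA0 := Real.sqrt_nonneg (r ^ 2 - d ^ 2)
  have hA'0 := Real.sqrt_nonneg (s ^ 2 - d ^ 2)
  have hB0 := Real.sqrt_nonneg (r ^ 2 - a ^ 2)
  have hB'0 := Real.sqrt_nonneg (s ^ 2 - a ^ 2)
  set A := √(r ^ 2 - d ^ 2)
  set A' := √(s ^ 2 - d ^ 2)
  set B := √(r ^ 2 - a ^ 2)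
  set B' := √(s ^ 2 - a ^ 2)
  have hr : 0 < r := by linarith
  have hs : 0 < s := by linarith
  have hpos : 0 < (s ^ 2 - r ^ 2) * (d ^ 2 - a ^ 2) := mul_pos (by nlinarith) (by nlinarith)
  have hprod : A * B' < A' * B := by
    refine lt_of_pow_lt_pow_left₀ 2 (by positivity) ?_
    rw [mul_pow, mul_pow, hA, hB', hA', hB]
    linarith
  have hcross : r * B' + s * A < s * B + r * A' := by
    refine lt_of_pow_lt_pow_left₀ 2 (by positivity) ?_
    have hrsprod : r * s * (A * B') < r * s * (A' * B) := by gcongr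
    have hL : (r * B' + s * A) ^ 2 =
        r ^ 2 * (s ^ 2 - a ^ 2) + s ^ 2 * (r ^ 2 - d ^ 2) + 2 * (r * s * (A * B')) := by
      rw [← hB', ← hA]; ring
    have hR : (s * B + r * A') ^ 2 =
        s ^ 2 * (r ^ 2 - a ^ 2) + r ^ 2 * (s ^ 2 - d ^ 2) + 2 * (r * s * (A' * B)) := by
      rw [← hB, ← hA']; ring
    rw [hL, hR]
    linarith
  linarith

lemma add_sqrt_mul_legGap_lt {a d r s : ℝ} (ha : 0 < a) (had : a < d) (hdr : d ≤ r)
    (hrs : r < s) :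
    (r + √(r ^ 2 - d ^ 2)) * legGap a r < (s + √(s ^ 2 - d ^ 2)) * legGap a s := by
  have hr : 0 < r := by linarith
  have hs : 0 < s := by linarith
  rw [legGap_eq_div ha.le (by linarith) hr, legGap_eq_div ha.le (by linarith) hs,
    mul_div_assoc', mul_div_assoc', div_lt_div_iff₀ (by positivity) (by positivity)]
  have := mul_lt_mul_of_pos_left (add_sqrt_mul_add_sqrt_lt ha.le had hdr hrs)
    (show 0 < a ^ 2 by positivity)
  linarith

lemma add_sqrt_mul_legGap_le {a d r s : ℝ} (ha : 0 ≤ a) (had : a ≤ d) (hd : 0 < d)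
    (hdr : d ≤ r) (hrs : r ≤ s) :
    (r + √(r ^ 2 - d ^ 2)) * legGap a r ≤ (s + √(s ^ 2 - d ^ 2)) * legGap a s := by
  rcases hrs.eq_or_lt with rfl | hrs
  · rfl
  rcases had.eq_or_lt with rfl | had
  · rw [mul_comm, legGap_mul_add ha hdr, mul_comm, legGap_mul_add ha (hdr.trans hrs.le)]
  rcases ha.eq_or_lt with rfl | ha
  · have hr : 0 < r := by linarith
    have hs : 0 < s := by linarith
    simp [legGap, Real.sqrt_sq, hr.le, hs.le]
  exact (add_sqrt_mul_legGap_lt ha had hdr hrs).le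

lemma add_sqrt_mul_legGap_le_sq {a d r : ℝ} (ha : 0 ≤ a) (had : a ≤ d) (hd : 0 < d)
    (hdr : d ≤ r) : (r + √(r ^ 2 - d ^ 2)) * legGap a r ≤ a ^ 2 := by
  have hr : 0 < r := by linarith
  have hg : 0 ≤ legGap a r :=
    le_trans (by positivity) (sq_div_two_mul_le_legGap ha (had.trans hdr) hr)
  rw [← legGap_mul_add ha (had.trans hdr), mul_comm]
  gcongr

section Sum

variable {ι : Type*} [Fintype ι] {c : ι → ℝ} {d : ℝ}

/-- The product `(r + √(r² - d²)) * ∑ k, legGap (c k) r`, which equals `d²` exactly at the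
solutions `r ≥ d` of `∑ k, legGap (c k) r = legGap d r`. -/
noncomputable def gapProduct (c : ι → ℝ) (d r : ℝ) : ℝ :=
  (r + √(r ^ 2 - d ^ 2)) * ∑ k, legGap (c k) r

lemma continuous_gapProduct : Continuous (gapProduct c d) := by
  unfold gapProduct legGap
  fun_prop

lemma gapProduct_eq_sq_iff {r : ℝ} (hd : 0 < d) (hdr : d ≤ r) :
    gapProduct c d r = d ^ 2 ↔ ∑ k, legGap (c k) r = legGap d r := by
  have hr : 0 < r := by linarith
  have hne : r + √(r ^ 2 - d ^ 2) ≠ 0 := by positivity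
  rw [← mul_left_inj' (b := legGap d r) hne, legGap_mul_add hd.le hdr, gapProduct, mul_comm]

lemma gapProduct_self : gapProduct c d d = d * ∑ k, legGap (c k) d := by
  simp [gapProduct]

lemma gapProduct_mono (hd : 0 < d) (hc : ∀ k, 0 ≤ c k) (hcd : ∀ k, c k ≤ d) {r s : ℝ}
    (hdr : d ≤ r) (hrs : r ≤ s) : gapProduct c d r ≤ gapProduct c d s := by
  simp only [gapProduct, Finset.mul_sum]
  exact Finset.sum_le_sum fun k _ => add_sqrt_mul_legGap_le (hc k) (hcd k) hd hdr hrs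

lemma gapProduct_lt (hd : 0 < d) (hc : ∀ k, 0 ≤ c k) (hcd : ∀ k, c k ≤ d)
    {j : ι} (hj : 0 < c j) (hjd : c j < d) {r s : ℝ}
    (hdr : d ≤ r) (hrs : r < s) : gapProduct c d r < gapProduct c d s := by
  simp only [gapProduct, Finset.mul_sum]
  exact Finset.sum_lt_sum
    (fun k _ => add_sqrt_mul_legGap_le (hc k) (hcd k) hd hdr hrs.le)
    ⟨j, Finset.mem_univ j, add_sqrt_mul_legGap_lt hj hjd hdr hrs⟩

lemma gapProduct_le_sum_sq (hd : 0 < d) (hc : ∀ k, 0 ≤ c k) (hcd : ∀ k, c k ≤ d) {r : ℝ}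
    (hdr : d ≤ r) : gapProduct c d r ≤ ∑ k, c k ^ 2 := by
  simp only [gapProduct, Finset.mul_sum]
  exact Finset.sum_le_sum fun k _ => add_sqrt_mul_legGap_le_sq (hc k) (hcd k) hd hdr

lemma sum_sq_div_le_sum_legGap (hc : ∀ k, 0 ≤ c k) {r : ℝ} (hr : 0 < r)
    (hcr : ∀ k, c k ≤ r) : (∑ k, c k ^ 2) / (2 * r) ≤ ∑ k, legGap (c k) r := by
  rw [Finset.sum_div]
  exact Finset.sum_le_sum fun k _ => sq_div_two_mul_le_legGap (hc k) (hcr k) hr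

lemma exists_sq_le_gapProduct (hd : 0 < d) (hc : ∀ k, 0 ≤ c k) (hcd : ∀ k, c k ≤ d)
    (hS : d ^ 2 < ∑ k, c k ^ 2) : ∃ r, d ≤ r ∧ d ^ 2 ≤ gapProduct c d r := by
  set S := ∑ k, c k ^ 2 with hSdef
  have hS0 : 0 < S := lt_trans (by positivity) hS
  have hpos : 0 < S - d ^ 2 := sub_pos.2 hS
  obtain ⟨r, hr⟩ : ∃ r, r = S * d / (S - d ^ 2) := ⟨_, rfl⟩
  have hrmul : r * (S - d ^ 2) = S * d := by rw [hr]; field_simp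
  have hdr : d ≤ r := by
    rw [hr, le_div_iff₀ hpos]
    nlinarith [pow_pos hd 3]
  have hr0 : 0 < r := by linarith
  refine ⟨r, hdr, ?_⟩
  have hsqrt : r - d ≤ √(r ^ 2 - d ^ 2) := Real.le_sqrt_of_sq_le (by nlinarith)
  have hsum := sum_sq_div_le_sum_legGap hc hr0 fun k => (hcd k).trans hdr
  calc d ^ 2 ≤ (r + (r - d)) * (S / (2 * r)) := by
        rw [mul_div_assoc', le_div_iff₀ (by positivity)]
        nlinarith [mul_pos hS0 hd]
    _ ≤ gapProduct c d r := by
        unfold gapProduct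
        gcongr

/-- If some `c j = d` and the gaps at `d` add up to at most `d`, all other `c k` vanish. -/
lemma sum_sq_le_of_sum_legGap_le (hd : 0 < d) (hc : ∀ k, 0 ≤ c k) (hcd : ∀ k, c k ≤ d)
    {j : ι} (hj : c j = d) (hsum : ∑ k, legGap (c k) d ≤ d) : ∑ k, c k ^ 2 ≤ d ^ 2 := by
  classical
  rw [← Finset.add_sum_erase _ _ (Finset.mem_univ j)] at hsum ⊢
  have hgj : legGap (c j) d = d := by simp [legGap, hj]
  have hle : (∑ k ∈ Finset.univ.erase j, c k ^ 2) / (2 * d) ≤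
      ∑ k ∈ Finset.univ.erase j, legGap (c k) d := by
    rw [Finset.sum_div]
    exact Finset.sum_le_sum fun k _ => sq_div_two_mul_le_legGap (hc k) (hcd k) hd
  have h0 : (∑ k ∈ Finset.univ.erase j, c k ^ 2) / (2 * d) ≤ 0 := by linarith
  rw [div_le_iff₀ (by positivity)] at h0
  rw [hj]
  linarith

end Sum

theorem asymmetric_stationarity_equation_solvability (m : ℕ) (hm : 2 ≤ m) (c : Fin m → ℝ)
    (hc : ∀ k, 0 ≤ c k) (C : ℝ) (hC : IsGreatest (Set.range c) C) (hCpos : 0 < C)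
    (d : ℝ) (hd : C ≤ d)
    (r₁ : ℝ) (hr₁ : C ≤ r₁)
    (heq₁ : (∑ k : Fin m, Real.sqrt (r₁ ^ 2 - (c k) ^ 2)) = ((m : ℝ) - 1) * r₁)
    (r₂ : ℝ) (hr₂ : r₂ = Real.sqrt (∑ k : Fin m, (c k) ^ 2)) :
    (r₁ ≤ d ∧ d < r₂ → ∃! r : ℝ, d ≤ r ∧
        (∑ k : Fin m, Real.sqrt (r ^ 2 - (c k) ^ 2)) - Real.sqrt (r ^ 2 - d ^ 2)
          = ((m : ℝ) - 1) * r) ∧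
      (d < r₁ → ¬∃ r : ℝ, d ≤ r ∧
        (∑ k : Fin m, Real.sqrt (r ^ 2 - (c k) ^ 2)) - Real.sqrt (r ^ 2 - d ^ 2)
          = ((m : ℝ) - 1) * r) ∧
      (r₂ < d → ¬∃ r : ℝ, d ≤ r ∧
        (∑ k : Fin m, Real.sqrt (r ^ 2 - (c k) ^ 2)) - Real.sqrt (r ^ 2 - d ^ 2)
          = ((m : ℝ) - 1) * r) := by
  have hd0 : 0 < d := hCpos.trans_le hd
  have hcC : ∀ k, c k ≤ C := fun k => hC.2 ⟨k, rfl⟩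
  have hcd : ∀ k, c k ≤ d := fun k => (hcC k).trans hd
  obtain ⟨j, hj⟩ := hC.1
  have hsum (r : ℝ) : ∑ k, legGap (c k) r = m * r - ∑ k, √(r ^ 2 - c k ^ 2) := by
    simp [legGap, Finset.sum_sub_distrib]
  have hsum₁ : ∑ k, legGap (c k) r₁ = r₁ := by rw [hsum, heq₁]; ring
  have hiff (r : ℝ) (hdr : d ≤ r) :
      (∑ k, √(r ^ 2 - c k ^ 2)) - √(r ^ 2 - d ^ 2) = ((m : ℝ) - 1) * r ↔
        gapProduct c d r = d ^ 2 := by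
    rw [gapProduct_eq_sq_iff hd0 hdr, hsum, legGap]
    constructor <;> intro h <;> linarith
  refine ⟨?_, ?_, ?_⟩
  · rintro ⟨h₁, h₂⟩
    have hS : d ^ 2 < ∑ k, c k ^ 2 := (Real.lt_sqrt hd0.le).1 (hr₂ ▸ h₂)
    have hsumd : ∑ k, legGap (c k) d ≤ d := calc
      _ ≤ ∑ k, legGap (c k) r₁ := Finset.sum_le_sum fun k _ =>
          legGap_antitone (hc k) ((hcC k).trans hr₁) (hCpos.trans_le hr₁) h₁
      _ ≤ d := hsum₁.trans_le h₁
    have hjd : c j < d := (hcd j).lt_of_ne fun h =>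
      hS.not_ge (sum_sq_le_of_sum_legGap_le hd0 hc hcd h hsumd)
    have hj0 : 0 < c j := hj ▸ hCpos
    have hself : gapProduct c d d ≤ d ^ 2 := by
      rw [gapProduct_self, sq]
      gcongr
    obtain ⟨R, hdR, hR⟩ := exists_sq_le_gapProduct hd0 hc hcd hS
    obtain ⟨r, hr, hreq⟩ := intermediate_value_Icc hdR
      continuous_gapProduct.continuousOn ⟨hself, hR⟩
    refine ⟨r, ⟨hr.1, (hiff r hr.1).2 hreq⟩, ?_⟩
    rintro s ⟨hds, hs⟩
    rw [hiff s hds] at hs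
    rcases lt_trichotomy s r with h | h | h
    · have := gapProduct_lt hd0 hc hcd hj0 hjd hds h
      linarith
    · exact h
    · have := gapProduct_lt hd0 hc hcd hj0 hjd hr.1 h
      linarith
  · rintro h₁ ⟨r, hdr, hr⟩
    rw [hiff r hdr] at hr
    have hsumd : r₁ ≤ ∑ k, legGap (c k) d := calc
      _ = ∑ k, legGap (c k) r₁ := hsum₁.symm
      _ ≤ _ := Finset.sum_le_sum fun k _ => legGap_antitone (hc k) (hcd k) hd0 h₁.le
    have hmono := gapProduct_mono hd0 hc hcd le_rfl hdr
    rw [gapProduct_self] at hmono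
    nlinarith
  · rintro h₂ ⟨r, hdr, hr⟩
    rw [hiff r hdr] at hr
    have hS : ∑ k, c k ^ 2 < d ^ 2 := (Real.sqrt_lt' hd0).1 (hr₂ ▸ h₂)
    have := gapProduct_le_sum_sq hd0 hc hcd hdr
    linarith
end

section
/- Let N : ℕ and let c : Fin N → ℝ satisfy c i ≥ 0 for all i and ∑_i (c i)² = 1. If r > 0 satisfies r ≥ c i for all i and ∑_i √(r² − (c i)²) = (N − 2)·r, then 1/4 ≤ r² ≤ 1/2. -/
open scoped BigOperators

theorem entanglement_diameter_bounds_symmetric (N : ℕ) (c : Fin N → ℝ)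
    (hc : ∀ i, 0 ≤ c i) (hnorm : (∑ i : Fin N, (c i) ^ 2) = 1)
    (r : ℝ) (hr : 0 < r) (hrc : ∀ i, c i ≤ r)
    (heq : (∑ i : Fin N, Real.sqrt (r ^ 2 - (c i) ^ 2)) = ((N : ℝ) - 2) * r) :
    1 / 4 ≤ r ^ 2 ∧ r ^ 2 ≤ 1 / 2 := by
  have hsum : ∑ i : Fin N, (r - Real.sqrt (r ^ 2 - (c i) ^ 2)) = 2 * r := by
    rw [Finset.sum_sub_distrib, heq]
    simp only [Finset.sum_const, Finset.card_univ, Fintype.card_fin, nsmul_eq_mul]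
    ring
  have hsq (i : Fin N) : Real.sqrt (r ^ 2 - (c i) ^ 2) ^ 2 = r ^ 2 - (c i) ^ 2 :=
    Real.sq_sqrt (sub_nonneg.2 (pow_le_pow_left₀ (hc i) (hrc i) 2))
  have hle (i : Fin N) : Real.sqrt (r ^ 2 - (c i) ^ 2) ≤ r :=
    Real.sqrt_le_iff.2 ⟨hr.le, by linarith [sq_nonneg (c i)]⟩
  have hlower : ∑ i : Fin N, r * (r - Real.sqrt (r ^ 2 - (c i) ^ 2)) ≤ ∑ i, (c i) ^ 2 :=
    Finset.sum_le_sum fun i _ => by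
      nlinarith [hsq i, mul_nonneg (Real.sqrt_nonneg (r ^ 2 - (c i) ^ 2)) (sub_nonneg.2 (hle i))]
  have hupper : ∑ i, (c i) ^ 2 ≤ ∑ i : Fin N, 2 * r * (r - Real.sqrt (r ^ 2 - (c i) ^ 2)) :=
    Finset.sum_le_sum fun i _ => by
      nlinarith [hsq i, sq_nonneg (r - Real.sqrt (r ^ 2 - (c i) ^ 2))]
  rw [← Finset.mul_sum, hsum, hnorm] at hlower hupper
  constructor <;> linarith
end

section
/- Let N : ℕ and let c : Fin N → ℝ satisfy c i ≥ 0 for all i and ∑_i (c i)² = 1. If r > 0 satisfies r ≥ c i for all i and for some index j one has (∑_{i ≠ j} √(r² − (c i)²)) − √(r² − (c j)²) = (N − 2)·r, then r² ≥ 1/3. -/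
open scoped BigOperators

theorem entanglement_diameter_bound_asymmetric (N : ℕ) (c : Fin N → ℝ)
    (hc : ∀ i, 0 ≤ c i) (hnorm : (∑ i : Fin N, (c i) ^ 2) = 1)
    (r : ℝ) (hr : 0 < r) (hrc : ∀ i, c i ≤ r) (j : Fin N)
    (heq : (∑ i ∈ Finset.univ.erase j, Real.sqrt (r ^ 2 - (c i) ^ 2))
        - Real.sqrt (r ^ 2 - (c j) ^ 2) = ((N : ℝ) - 2) * r) :
    1 / 3 ≤ r ^ 2 := by
  have hsq (i : Fin N) : Real.sqrt (r ^ 2 - (c i) ^ 2) ^ 2 = r ^ 2 - (c i) ^ 2 :=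
    Real.sq_sqrt (by nlinarith [hc i, hrc i])
  have hle : ∑ i ∈ Finset.univ.erase j, (c i) ^ 2 ≤
      ∑ i ∈ Finset.univ.erase j, 2 * r * (r - Real.sqrt (r ^ 2 - (c i) ^ 2)) :=
    Finset.sum_le_sum fun i _ => by
      nlinarith [hsq i, sq_nonneg (r - Real.sqrt (r ^ 2 - (c i) ^ 2))]
  have hcard : ((Finset.univ.erase j).card : ℝ) = N - 1 := by
    rw [Finset.cast_card_erase_of_mem (Finset.mem_univ j), Finset.card_univ, Fintype.card_fin]
  rw [← Finset.mul_sum, Finset.sum_sub_distrib, Finset.sum_const, nsmul_eq_mul, hcard] at hle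
  rw [← Finset.sum_erase_add _ _ (Finset.mem_univ j)] at hnorm
  have hsum : ((N : ℝ) - 1) * r - ∑ i ∈ Finset.univ.erase j, Real.sqrt (r ^ 2 - (c i) ^ 2) =
      r - Real.sqrt (r ^ 2 - (c j) ^ 2) := by
    linarith
  rw [hsum] at hle
  nlinarith [hsq j, mul_nonneg hr.le (Real.sqrt_nonneg (r ^ 2 - (c j) ^ 2))]
end

section
/- Let m, k be natural numbers with m ≥ 2 and k ≥ 2, set N = m + k, and let θ ∈ [0, π/2]. Define a = cos θ / √m, b = sin θ / √k, D = 1 − ((N − 1)/(m·k))·(sin(2θ))², and R = (2·N·m·k − 4·(N − 1)·(m·cos²θ + k·sin²θ) + 2·m·k·(N − 2)·√D) / (16·(N − 1)·(m − 1)·(k − 1)). Then D ≥ 0, R ≥ a², R ≥ b², and the positive square root r = √R satisfies m·√(r² − a²) + k·√(r² − b²) = (N − 2)·r. -/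
open scoped BigOperators

/-- The factored form of `√R * √(R - b ^ 2)`, up to a positive constant, is nonnegative. Here `y`
stands for `b ^ 2` and `s` for the square root of the discriminant. -/
lemma branch_nonneg (m k y s : ℝ) (hm : 2 ≤ m) (hk : 2 ≤ k) (hy : 0 ≤ y) (hy1 : k * y ≤ 1)
    (hs0 : 0 ≤ s) (hs : m * s ^ 2 = m - 4 * (m + k - 1) * y * (1 - k * y)) :
    0 ≤ (m + k - 2) * (m * k - 2 * (m + k - 1) * (k * y))
      + m * ((k - 1) * (m + k - 1) - (m - 1)) * s := by
  have hA : 0 ≤ (k - 1) * (m + k - 1) - (m - 1) := by nlinarith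
  have hmAs : 0 ≤ m * ((k - 1) * (m + k - 1) - (m - 1)) * s := by positivity
  by_cases h : 2 * (m + k - 1) * y ≤ m
  · have h1 : 0 ≤ (m + k - 2) * (m * k - 2 * (m + k - 1) * (k * y)) :=
      mul_nonneg (by linarith) (by nlinarith)
    linarith
  · push Not at h
    have hS : 0 ≤ k * y := by positivity
    have h1 : m * s ^ 2 ≤ m * (k * y) ^ 2 := by
      have h2 := mul_nonneg (sub_nonneg.2 h.le) (sub_nonneg.2 hy1)
      have h3 : 0 ≤ m * (1 - k * y) ^ 2 := by positivity
      nlinarith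
    have h4 : s ≤ k * y := (sq_le_sq₀ hs0 hS).1 (le_of_mul_le_mul_left h1 (by linarith))
    have h5 : m * s ≤ (m + k - 2) * (k * y) :=
      mul_le_mul (by linarith) h4 hs0 (by linarith)
    have h6 : (m * s) ^ 2 ≤ ((m + k - 2) * (k * y)) ^ 2 :=
      pow_le_pow_left₀ (by positivity) h5 2
    have hK : 0 ≤ (m + k - 1) * (m - 1) * (k - 1) :=
      mul_nonneg (mul_nonneg (by linarith) (by linarith)) (by linarith)
    have h7 : 0 ≤ (m + k - 2) * (2 * (m + k - 1) * (k * y) - m * k) :=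
      mul_nonneg (by linarith) (by nlinarith)
    have h8 : ((m + k - 2) * (2 * (m + k - 1) * (k * y) - m * k)) ^ 2
        ≤ (m * ((k - 1) * (m + k - 1) - (m - 1)) * s) ^ 2 := by
      have h9 := mul_nonneg hK (sub_nonneg.2 h6)
      have h10 : (m * ((k - 1) * (m + k - 1) - (m - 1)) * s) ^ 2
          - ((m + k - 2) * (2 * (m + k - 1) * (k * y) - m * k)) ^ 2
          = 4 * ((m + k - 1) * (m - 1) * (k - 1)
            * (((m + k - 2) * (k * y)) ^ 2 - (m * s) ^ 2)) := by
        linear_combination (m * k ^ 2 * (m + k - 2) ^ 2) * hs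
      linarith
    have h11 := (sq_le_sq₀ h7 hmAs).1 h8
    linarith

lemma le_and_mul_sqrt_eq {K L R y : ℝ} (hR : 0 < R) (hK : 0 < K) (hL : 0 ≤ L)
    (h : K ^ 2 * (R * (R - y)) = L ^ 2) : y ≤ R ∧ K * (√R * √(R - y)) = L := by
  have h0 : 0 ≤ R * (R - y) :=
    nonneg_of_mul_nonneg_right (h ▸ sq_nonneg L) (pow_pos hK 2)
  refine ⟨sub_nonneg.1 (nonneg_of_mul_nonneg_right h0 hR), ?_⟩
  rw [← Real.sqrt_mul hR.le]
  refine (sq_eq_sq₀ (by positivity) hL).1 ?_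
  rw [mul_pow, Real.sq_sqrt h0, h]

/-- The bound `b ^ 2 ≤ R` and the closed form of `√R * √(R - b ^ 2)`, where `x` and `y` stand for
`a ^ 2` and `b ^ 2`. -/
lemma sqrt_mul_sqrt_sub_eq (m k x y s R : ℝ) (hm : 2 ≤ m) (hk : 2 ≤ k) (hx : 0 ≤ x) (hy : 0 ≤ y)
    (hxy : m * x + k * y = 1) (hs0 : 0 ≤ s) (hs : s ^ 2 = 1 - 4 * (m + k - 1) * x * y)
    (hR0 : 0 < R)
    (hR : 8 * ((m + k - 1) * (m - 1) * (k - 1)) * R = (m + k) * m * k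
      - 2 * (m + k - 1) * (m * (m * x) + k * (k * y)) + m * k * (m + k - 2) * s) :
    y ≤ R ∧ 8 * ((m + k - 1) * (m - 1) * (k - 1)) * (√R * √(R - y))
      = (m + k - 2) * (m * k - 2 * (m + k - 1) * (k * y))
      + m * ((k - 1) * (m + k - 1) - (m - 1)) * s := by
  have hs' : m * s ^ 2 = m - 4 * (m + k - 1) * y * (1 - k * y) := by
    linear_combination m * hs - 4 * (m + k - 1) * y * hxy
  have hL := branch_nonneg m k y s hm hk hy (by nlinarith) hs0 hs'
  have hK : 0 < 8 * ((m + k - 1) * (m - 1) * (k - 1)) := by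
    have : 0 < m - 1 := by linarith
    have : 0 < k - 1 := by linarith
    have : 0 < m + k - 1 := by linarith
    positivity
  have hmx : m * x = 1 - k * y := by linarith
  rw [hmx] at hR
  refine le_and_mul_sqrt_eq hR0 hK hL ?_
  have e : (8 * ((m + k - 1) * (m - 1) * (k - 1))) ^ 2 * (R * (R - y))
      = (8 * ((m + k - 1) * (m - 1) * (k - 1)) * R)
        * (8 * ((m + k - 1) * (m - 1) * (k - 1)) * R
          - 8 * ((m + k - 1) * (m - 1) * (k - 1)) * y) := by ring
  rw [e, hR]
  linear_combination (4 * m * ((m + k - 1) * (m - 1) * (k - 1))) * hs'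

theorem two_parameter_W_state_diameter (m k : ℕ) (hm : 2 ≤ m) (hk : 2 ≤ k)
    (N : ℕ) (hN : N = m + k) (θ : ℝ) (hθ : θ ∈ Set.Icc 0 (Real.pi / 2))
    (a b D R r : ℝ)
    (hab : a = Real.cos θ / Real.sqrt m) (hbb : b = Real.sin θ / Real.sqrt k)
    (hD : D = 1 - (((N : ℝ) - 1) / ((m : ℝ) * (k : ℝ))) * (Real.sin (2 * θ)) ^ 2)
    (hR : R = (2 * (N : ℝ) * (m : ℝ) * (k : ℝ)
        - 4 * ((N : ℝ) - 1) * ((m : ℝ) * (Real.cos θ) ^ 2 + (k : ℝ) * (Real.sin θ) ^ 2)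
        + 2 * (m : ℝ) * (k : ℝ) * ((N : ℝ) - 2) * Real.sqrt D)
        / (16 * ((N : ℝ) - 1) * ((m : ℝ) - 1) * ((k : ℝ) - 1)))
    (hrR : r = Real.sqrt R) :
    0 ≤ D ∧ a ^ 2 ≤ R ∧ b ^ 2 ≤ R ∧
      (m : ℝ) * Real.sqrt (r ^ 2 - a ^ 2) + (k : ℝ) * Real.sqrt (r ^ 2 - b ^ 2)
        = ((N : ℝ) - 2) * r := by
  have hm' : (2 : ℝ) ≤ m := by exact_mod_cast hm
  have hk' : (2 : ℝ) ≤ k := by exact_mod_cast hk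
  have hNr : (N : ℝ) = m + k := by rw [hN]; push_cast; ring
  have ha2 : a ^ 2 = Real.cos θ ^ 2 / m := by
    rw [hab, div_pow, Real.sq_sqrt (by positivity)]
  have hb2 : b ^ 2 = Real.sin θ ^ 2 / k := by
    rw [hbb, div_pow, Real.sq_sqrt (by positivity)]
  have hma : (m : ℝ) * a ^ 2 = Real.cos θ ^ 2 := by rw [ha2]; field_simp
  have hkb : (k : ℝ) * b ^ 2 = Real.sin θ ^ 2 := by rw [hb2]; field_simp
  rw [hNr] at hD hR ⊢
  have hDxy : D = 1 - 4 * ((m : ℝ) + k - 1) * a ^ 2 * b ^ 2 := by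
    rw [hD, ha2, hb2, Real.sin_two_mul]; field_simp; ring
  rw [← hma, ← hkb] at hR
  have hxy : (m : ℝ) * a ^ 2 + k * b ^ 2 = 1 := by
    rw [hma, hkb]; exact Real.cos_sq_add_sin_sq θ
  have hx := sq_nonneg a
  have hy := sq_nonneg b
  have hm1 : (0 : ℝ) < m - 1 := by linarith
  have hk1 : (0 : ℝ) < k - 1 := by linarith
  have hN1 : (0 : ℝ) < (m : ℝ) + k - 1 := by linarith
  have hD0 : 0 ≤ D := by
    have h1 : 4 * ((m : ℝ) * k * (a ^ 2 * b ^ 2)) ≤ 1 := by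
      nlinarith [sq_nonneg ((m : ℝ) * a ^ 2 - k * b ^ 2)]
    have h2 : 0 ≤ ((m : ℝ) - 1) * (k - 1) * (a ^ 2 * b ^ 2) := by positivity
    rw [hDxy]
    linarith
  have hs : √D ^ 2 = 1 - 4 * ((m : ℝ) + k - 1) * a ^ 2 * b ^ 2 := by
    rw [Real.sq_sqrt hD0, hDxy]
  have hs0 := Real.sqrt_nonneg D
  have hRmul : 8 * (((m : ℝ) + k - 1) * (m - 1) * (k - 1)) * R = ((m : ℝ) + k) * m * k
      - 2 * (m + k - 1) * (m * (m * a ^ 2) + k * (k * b ^ 2)) + m * k * (m + k - 2) * √D := by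
    rw [hR]; field_simp; ring
  have hR0 : 0 < R := by
    have hp : (0 : ℝ) < (m + k) * k - 2 * (m + k - 1) := by nlinarith
    have hq : (0 : ℝ) < (m + k) * m - 2 * (m + k - 1) := by nlinarith
    have hu : 0 ≤ (m : ℝ) * a ^ 2 := by positivity
    have hv : 0 ≤ (k : ℝ) * b ^ 2 := by positivity
    have hsum : 0 < ((m : ℝ) * a ^ 2) * (m * ((m + k) * k - 2 * (m + k - 1)))
        + (k * b ^ 2) * (k * ((m + k) * m - 2 * (m + k - 1))) := by
      have hp' := mul_pos (by linarith : (0 : ℝ) < m) hp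
      have hq' := mul_pos (by linarith : (0 : ℝ) < k) hq
      rcases hu.eq_or_lt with h | h
      · have : (k : ℝ) * b ^ 2 = 1 := by linarith
        rw [← h, this]; linarith
      · exact add_pos_of_pos_of_nonneg (mul_pos h hp') (mul_nonneg hv hq'.le)
    have hlast : 0 ≤ (m : ℝ) * k * (m + k - 2) * √D :=
      mul_nonneg (mul_nonneg (by positivity) (by linarith)) hs0
    refine pos_of_mul_pos_right (a := 8 * (((m : ℝ) + k - 1) * (m - 1) * (k - 1))) ?_
      (by positivity)
    rw [hRmul]
    linear_combination hsum + hlast + (m * k * ((m : ℝ) + k)) * hxy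
  obtain ⟨hyR, hB⟩ := sqrt_mul_sqrt_sub_eq m k (a ^ 2) (b ^ 2) (√D) R hm' hk' hx hy hxy hs0 hs hR0
    hRmul
  obtain ⟨hxR, hA⟩ := sqrt_mul_sqrt_sub_eq k m (b ^ 2) (a ^ 2) (√D) R hk' hm' hy hx
    (by linarith) hs0 (by linarith) hR0 (by linarith)
  refine ⟨hD0, hxR, hyR, ?_⟩
  have hr2 : √R ^ 2 = R := Real.sq_sqrt hR0.le
  have hK : 8 * (((m : ℝ) + k - 1) * (m - 1) * (k - 1)) ≠ 0 := by positivity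
  rw [hrR, hr2]
  refine mul_left_cancel₀ (Real.sqrt_pos.2 hR0).ne' (mul_left_cancel₀ hK ?_)
  linear_combination (m : ℝ) * hA + k * hB
    - 8 * (((m : ℝ) + k - 1) * (m - 1) * (k - 1)) * (m + k - 2) * hr2
    - ((m : ℝ) + k - 2) * hRmul
end

section
/- Let λ₀, λ₁, λ₂, λ₃ be real numbers with λ₁, λ₂, λ₃ ≥ 0 and λ₀ ≥ max(λ₁, λ₂, λ₃), and let A be the 3×3 real symmetric matrix with diagonal entries all equal to λ₀ and off-diagonal entries A₁₂ = A₂₁ = −λ₃, A₁₃ = A₃₁ = −λ₂, A₂₃ = A₃₂ = −λ₁. Then A is positive semidefinite if and only if λ₀³ ≥ λ₀·(λ₁² + λ₂² + λ₃²) + 2·λ₁·λ₂·λ₃. (For λ₀ > 0 this is the non-strict inequality λ₀² ≥ λ₁² + λ₂² + λ₃² + 2·λ₁·λ₂·λ₃/λ₀ that three-qubit Schmidt coefficients must satisfy.) -/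
open scoped BigOperators

/-- A real binary quadratic form with nonnegative diagonal and determinant is nonnegative. -/
lemma binary_form_nonneg_s17 {p q r : ℝ} (hp : 0 ≤ p) (hq : 0 ≤ q) (h : r ^ 2 ≤ p * q) (y z : ℝ) :
    0 ≤ p * y ^ 2 - 2 * r * y * z + q * z ^ 2 := by
  have hs : 2 * r * y * z ≤ p * y ^ 2 + q * z ^ 2 := by
    refine le_of_sq_le_sq ?_ (by positivity)
    nlinarith [sq_nonneg (p * y ^ 2 - q * z ^ 2),
      mul_le_mul_of_nonneg_right h (sq_nonneg (y * z))]
  linarith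

/-- A real ternary quadratic form with constant diagonal `a` is nonnegative as soon as its
principal minors are. -/
lemma ternary_form_nonneg {a b c d : ℝ} (hb : 0 ≤ b) (hc : 0 ≤ c) (hd : 0 ≤ d)
    (hba : b ≤ a) (hca : c ≤ a) (hda : d ≤ a)
    (h : a * (b ^ 2 + c ^ 2 + d ^ 2) + 2 * b * c * d ≤ a ^ 3) (x y z : ℝ) :
    0 ≤ a * (x ^ 2 + y ^ 2 + z ^ 2) - 2 * d * x * y - 2 * c * x * z - 2 * b * y * z := by
  rcases (hb.trans hba).eq_or_lt with rfl | ha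
  · obtain rfl : b = 0 := le_antisymm hba hb
    obtain rfl : c = 0 := le_antisymm hca hc
    obtain rfl : d = 0 := le_antisymm hda hd
    simp
  · have hform := binary_form_nonneg_s17 (p := a ^ 2 - d ^ 2) (q := a ^ 2 - c ^ 2)
      (r := a * b + c * d) (by nlinarith) (by nlinarith)
      (by nlinarith [mul_le_mul_of_nonneg_left h ha.le]) y z
    refine (mul_nonneg_iff_of_pos_left ha).mp ?_
    nlinarith [sq_nonneg (a * x - d * y - c * z)]

theorem schmidt_hessian_posSemidef_iff (Λ₀ Λ₁ Λ₂ Λ₃ : ℝ)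
    (h₁ : 0 ≤ Λ₁) (h₂ : 0 ≤ Λ₂) (h₃ : 0 ≤ Λ₃)
    (h₀ : max Λ₁ (max Λ₂ Λ₃) ≤ Λ₀)
    (A : Matrix (Fin 3) (Fin 3) ℝ)
    (hA : A = !![Λ₀, -Λ₃, -Λ₂; -Λ₃, Λ₀, -Λ₁; -Λ₂, -Λ₁, Λ₀]) :
    A.PosSemidef ↔ Λ₀ * (Λ₁ ^ 2 + Λ₂ ^ 2 + Λ₃ ^ 2) + 2 * Λ₁ * Λ₂ * Λ₃ ≤ Λ₀ ^ 3 := by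
  simp only [max_le_iff] at h₀
  obtain ⟨h₁₀, h₂₀, h₃₀⟩ := h₀
  subst hA
  constructor
  · intro h
    have hdet := h.det_nonneg
    simp [Matrix.det_fin_three] at hdet
    linarith
  · intro h
    refine .of_dotProduct_mulVec_nonneg ?_ fun x => ?_
    · ext i j
      fin_cases i <;> fin_cases j <;> simp
    · have hx := ternary_form_nonneg h₁ h₂ h₃ h₁₀ h₂₀ h₃₀ h (x 0) (x 1) (x 2)
      simp [dotProduct, Matrix.mulVec, Fin.sum_univ_three]
      linarith
end

section
/- Let a, b, c, d be nonnegative reals with a² + b² + c² + d² = 1, let l = max(a, b, c, d), and suppose l⁴ = l²/2 + a·b·c·d (i.e. the state lies on the surface separating the circumradius and largest-coefficient regimes of the geometric measure). Then 1/2 ≤ l² ≤ 4/7. -/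
theorem twenty_seven_mul_le_add_pow_three {u v w : ℝ} (hu : 0 ≤ u) (hv : 0 ≤ v) (hw : 0 ≤ w) :
    27 * (u * v * w) ≤ (u + v + w) ^ 3 := by
  nlinarith [mul_nonneg hu (sq_nonneg (v - w)), mul_nonneg hv (sq_nonneg (u - w)),
    mul_nonneg hw (sq_nonneg (u - v)), mul_nonneg hu (sq_nonneg (u - v)),
    mul_nonneg hu (sq_nonneg (u - w)), mul_nonneg hv (sq_nonneg (u - v)),
    mul_nonneg hv (sq_nonneg (v - w)), mul_nonneg hw (sq_nonneg (u - w)),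
    mul_nonneg hw (sq_nonneg (v - w))]

theorem sq_range_of_pow_four_eq {l x y z : ℝ} (hl : 0 < l) (hx : 0 ≤ x) (hy : 0 ≤ y)
    (hz : 0 ≤ z) (hnorm : l ^ 2 + x ^ 2 + y ^ 2 + z ^ 2 = 1)
    (hsurf : l ^ 4 = l ^ 2 / 2 + l * x * y * z) :
    1 / 2 ≤ l ^ 2 ∧ l ^ 2 ≤ 4 / 7 := by
  have hxyz : l * (l ^ 2 - 1 / 2) = x * y * z :=
    mul_left_cancel₀ hl.ne' (by linear_combination hsurf)
  have hlow : 1 / 2 ≤ l ^ 2 := by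
    have : 0 ≤ l * (l ^ 2 - 1 / 2) := hxyz ▸ by positivity
    linarith [nonneg_of_mul_nonneg_right this hl]
  refine ⟨hlow, ?_⟩
  have hamgm := twenty_seven_mul_le_add_pow_three (sq_nonneg x) (sq_nonneg y) (sq_nonneg z)
  rw [show x ^ 2 * y ^ 2 * z ^ 2 = (l * (l ^ 2 - 1 / 2)) ^ 2 by rw [hxyz]; ring,
    show x ^ 2 + y ^ 2 + z ^ 2 = 1 - l ^ 2 by linarith] at hamgm
  have hfactor : (l ^ 2 - 4 / 7) * (4 * l ^ 2 - 1) ^ 2 ≤ 0 := by linarith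
  have hpos : 0 < (4 * l ^ 2 - 1) ^ 2 := pow_pos (by linarith) 2
  linarith [nonpos_of_mul_nonpos_left hfactor hpos]

theorem shared_state_eigenvalue_range (a b c d : ℝ)
    (ha : 0 ≤ a) (hb : 0 ≤ b) (hc : 0 ≤ c) (hd : 0 ≤ d)
    (hnorm : a ^ 2 + b ^ 2 + c ^ 2 + d ^ 2 = 1)
    (l : ℝ) (hl : l = max (max a b) (max c d))
    (hsurf : l ^ 4 = l ^ 2 / 2 + a * b * c * d) :
    1 / 2 ≤ l ^ 2 ∧ l ^ 2 ≤ 4 / 7 := by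
  have hal : a ≤ l := by simp [hl]
  have hbl : b ≤ l := by simp [hl]
  have hcl : c ≤ l := by simp [hl]
  have hdl : d ≤ l := by simp [hl]
  have hpos : 0 < l := by
    by_contra! h
    have ha0 : a = 0 := by linarith
    have hb0 : b = 0 := by linarith
    have hc0 : c = 0 := by linarith
    have hd0 : d = 0 := by linarith
    norm_num [ha0, hb0, hc0, hd0] at hnorm
  have hcases : l = a ∨ l = b ∨ l = c ∨ l = d := by
    grind
  rcases hcases with rfl | rfl | rfl | rfl
  · exact sq_range_of_pow_four_eq hpos hb hc hd hnorm hsurf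
  · exact sq_range_of_pow_four_eq hpos ha hc hd (by linarith) (by linarith)
  · exact sq_range_of_pow_four_eq hpos ha hb hd (by linarith) (by linarith)
  · exact sq_range_of_pow_four_eq hpos ha hb hc (by linarith) (by linarith)
end

section
/- Let λ₀, λ₁, λ₂, λ₃, λ₄ be nonnegative reals with λ₀² + λ₁² + λ₂² + λ₃² + λ₄² = 1 and let φ ∈ ℝ. Define the polynomial local-unitary invariants J₁ = λ₁²·λ₄² + λ₂²·λ₃² − 2·λ₁·λ₂·λ₃·λ₄·cos φ, J₂ = λ₀²·λ₂², J₃ = λ₀²·λ₃², J₄ = λ₀²·λ₄², and J₅ = λ₀²·(J₁ + λ₂²·λ₃² − λ₁²·λ₄²). Then (J₁ + J₄)·λ₀⁴ − (J₅ + J₄)·λ₀² + J₂·J₃ + J₂·J₄ + J₃·J₄ + J₄² = 0. -/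
theorem schmidt_invariants_quadratic_relation (Λ₀ Λ₁ Λ₂ Λ₃ Λ₄ : ℝ)
    (h₀ : 0 ≤ Λ₀) (h₁ : 0 ≤ Λ₁) (h₂ : 0 ≤ Λ₂) (h₃ : 0 ≤ Λ₃) (h₄ : 0 ≤ Λ₄)
    (hnorm : Λ₀ ^ 2 + Λ₁ ^ 2 + Λ₂ ^ 2 + Λ₃ ^ 2 + Λ₄ ^ 2 = 1) (φ : ℝ)
    (J₁ J₂ J₃ J₄ J₅ : ℝ)
    (hJ₁ : J₁ = Λ₁ ^ 2 * Λ₄ ^ 2 + Λ₂ ^ 2 * Λ₃ ^ 2 - 2 * Λ₁ * Λ₂ * Λ₃ * Λ₄ * Real.cos φ)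
    (hJ₂ : J₂ = Λ₀ ^ 2 * Λ₂ ^ 2) (hJ₃ : J₃ = Λ₀ ^ 2 * Λ₃ ^ 2) (hJ₄ : J₄ = Λ₀ ^ 2 * Λ₄ ^ 2)
    (hJ₅ : J₅ = Λ₀ ^ 2 * (J₁ + Λ₂ ^ 2 * Λ₃ ^ 2 - Λ₁ ^ 2 * Λ₄ ^ 2)) :
    (J₁ + J₄) * Λ₀ ^ 4 - (J₅ + J₄) * Λ₀ ^ 2 + J₂ * J₃ + J₂ * J₄ + J₃ * J₄ + J₄ ^ 2 = 0 := by
  subst hJ₅ hJ₂ hJ₃ hJ₄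
  linear_combination Λ₀ ^ 4 * Λ₄ ^ 2 * hnorm
end
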